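/- arXiv:2311.04337 — 3 statements merged into one kernel-verified Lean document; each statement's English description precedes it below -/
import Mathlib

section
/- Let G be an undirected graph and k ≥ 2 a rational number. An orientation E⁺ of G admits a nowhere-zero circular k-flow (i.e., a circulation f with 1 ≤ f_e ≤ k−1 on every arc of E⁺) if and only if E⁺ is k-cut-balanced: for every nonempty proper vertex subset U, (1/k)|δ_G(U)| ≤ |δ⁺_{E⁺}(U)| ≤ ((k−1)/k)|δ_G(U)|. -/
open Finset

variable {V A : Type*} [Fintype V] [DecidableEq V] [Fintype A] [DecidableEq A]

/-- The arcs of the orientation leaving the vertex set `U`. -/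
def outArcs (src tgt : A → V) (U : Finset V) : Finset A :=
  univ.filter fun a => src a ∈ U ∧ tgt a ∉ U

/-- The arcs of the orientation entering the vertex set `U`. -/
def inArcs (src tgt : A → V) (U : Finset V) : Finset A :=
  univ.filter fun a => tgt a ∈ U ∧ src a ∉ U

/-- The edges of the underlying undirected graph crossing the cut induced by `U`. -/
def cutEdges (src tgt : A → V) (U : Finset V) : Finset A :=
  outArcs src tgt U ∪ inArcs src tgt U

/-- Capacity of the cut `U`: upper bounds on the leaving arcs minus lower bounds on the entering
arcs. -/
def cutSlack (src tgt : A → V) (l u : A → ℤ) (U : Finset V) : ℤ :=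
  ∑ a, ((if src a ∈ U ∧ tgt a ∉ U then u a else 0) - (if tgt a ∈ U ∧ src a ∉ U then l a else 0))

lemma cutSlack_eq {V A : Type*} [DecidableEq V] [Fintype A]
    (src tgt : A → V) (l u : A → ℤ) (U : Finset V) :
    cutSlack src tgt l u U = ∑ a ∈ outArcs src tgt U, u a - ∑ a ∈ inArcs src tgt U, l a := by
  simp only [cutSlack, outArcs, inArcs, sum_sub_distrib, sum_filter]

/-- Submodularity of the cut slack, with a strict gain from an arc crossing the two sets in
opposite directions. -/
lemma cutSlack_inter_add_union_lt {V A : Type*} [DecidableEq V] [Fintype A]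
    (src tgt : A → V) {l u : A → ℤ} (hlu : ∀ a, l a ≤ u a)
    {U W : Finset V} {a : A} (ha : l a < u a) (hU : tgt a ∈ U ∧ src a ∉ U)
    (hW : src a ∈ W ∧ tgt a ∉ W) :
    cutSlack src tgt l u (U ∩ W) + cutSlack src tgt l u (U ∪ W)
      < cutSlack src tgt l u U + cutSlack src tgt l u W := by
  simp only [cutSlack, ← sum_add_distrib]
  refine sum_lt_sum (fun b _ => ?_) ⟨a, mem_univ a, ?_⟩
  · have := hlu b
    by_cases h1 : src b ∈ U <;> by_cases h2 : src b ∈ W <;> by_cases h3 : tgt b ∈ U <;>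
      by_cases h4 : tgt b ∈ W <;> simp [h1, h2, h3, h4] <;> omega
  · simp [hU, hW, ha]

lemma cutSlack_update_lower {V A : Type*} [DecidableEq V] [Fintype A] [DecidableEq A]
    (src tgt : A → V) (l u : A → ℤ) (a : A) (U : Finset V) :
    cutSlack src tgt (Function.update l a (l a + 1)) u U
      = cutSlack src tgt l u U - if tgt a ∈ U ∧ src a ∉ U then 1 else 0 := by
  rw [eq_sub_iff_add_eq, ← eq_sub_iff_add_eq', eq_comm, cutSlack, cutSlack, ← sum_sub_distrib,
    sum_eq_single a]
  · split_ifs <;> simp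
  · intro b _ hb
    simp [Function.update_of_ne hb]
  · simp

lemma cutSlack_update_upper {V A : Type*} [DecidableEq V] [Fintype A] [DecidableEq A]
    (src tgt : A → V) (l u : A → ℤ) (a : A) (U : Finset V) :
    cutSlack src tgt l (Function.update u a (u a - 1)) U
      = cutSlack src tgt l u U - if src a ∈ U ∧ tgt a ∉ U then 1 else 0 := by
  rw [eq_sub_iff_add_eq, ← eq_sub_iff_add_eq', eq_comm, cutSlack, cutSlack, ← sum_sub_distrib,
    sum_eq_single a]
  · split_ifs <;> simp
  · intro b _ hb
    simp [Function.update_of_ne hb]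
  · simp

/-- For any arc weights, the weight leaving `U` minus the weight entering `U` is the total net
outflow of the vertices of `U`. -/
lemma sum_outArcs_sub_sum_inArcs {V A : Type*} [DecidableEq V] [Fintype A]
    {R : Type*} [AddCommGroup R] (src tgt : A → V) (f : A → R)
    (U : Finset V) :
    ∑ a ∈ outArcs src tgt U, f a - ∑ a ∈ inArcs src tgt U, f a
      = ∑ v ∈ U, (∑ a ∈ univ.filter (fun a => src a = v), f a
          - ∑ a ∈ univ.filter (fun a => tgt a = v), f a) := by
  simp only [outArcs, inArcs, sum_filter, sum_sub_distrib]
  rw [sum_comm, sum_comm (s := U)]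
  simp only [sum_ite_eq, ← sum_sub_distrib]
  refine sum_congr rfl fun a _ => ?_
  by_cases h1 : src a ∈ U <;> by_cases h2 : tgt a ∈ U <;> simp [h1, h2]

/-- Hoffman's circulation theorem (sufficiency), integral version. -/
theorem exists_circulation_of_cutSlack_nonneg (src tgt : A → V) (l u : A → ℤ)
    (hlu : ∀ a, l a ≤ u a) (hcut : ∀ U, 0 ≤ cutSlack src tgt l u U) :
    ∃ f : A → ℤ,
      (∀ v : V, ∑ a ∈ univ.filter (fun a => src a = v), f a
              = ∑ a ∈ univ.filter (fun a => tgt a = v), f a) ∧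
      ∀ a, l a ≤ f a ∧ f a ≤ u a := by
  induction hn : (∑ a, (u a - l a)).toNat using Nat.strong_induction_on generalizing l u with
  | _ n ih =>
  by_cases hall : ∀ a, l a = u a
  · obtain rfl : l = u := funext hall
    refine ⟨l, ?_, fun a => ⟨le_rfl, le_rfl⟩⟩
    have hnonneg : ∀ U : Finset V, 0 ≤ ∑ v ∈ U,
        (∑ a ∈ univ.filter (fun a => src a = v), l a
          - ∑ a ∈ univ.filter (fun a => tgt a = v), l a) := fun U => by
      rw [← sum_outArcs_sub_sum_inArcs, ← cutSlack_eq]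
      exact hcut U
    have htotal := sum_outArcs_sub_sum_inArcs src tgt l univ
    simp only [outArcs, inArcs, mem_univ, not_true_eq_false, and_false, filter_false, sum_empty,
      sub_zero] at htotal
    intro v
    refine sub_eq_zero.mp ((sum_eq_zero_iff_of_nonneg fun w _ => ?_).mp htotal.symm v (mem_univ v))
    simpa using hnonneg {w}
  · push Not at hall
    obtain ⟨a, hne⟩ := hall
    have ha : l a < u a := lt_of_le_of_ne (hlu a) hne
    have hpos : 0 < ∑ b, (u b - l b) :=
      sum_pos' (fun b _ => sub_nonneg.mpr (hlu b)) ⟨a, mem_univ a, sub_pos.mpr ha⟩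
    by_cases hL : ∀ U, 0 ≤ cutSlack src tgt (Function.update l a (l a + 1)) u U
    · have hl : ∀ b, l b ≤ Function.update l a (l a + 1) b := fun b => by
        rcases eq_or_ne b a with rfl | hb <;> simp [*]
      have hsum : ∑ b, (u b - Function.update l a (l a + 1) b) < ∑ b, (u b - l b) :=
        sum_lt_sum (fun b _ => sub_le_sub_left (hl b) _) ⟨a, mem_univ a, by simp⟩
      obtain ⟨f, hf, hb⟩ := ih _ (by omega) (Function.update l a (l a + 1)) u (fun b => by
        rcases eq_or_ne b a with rfl | hb
        · simpa using ha
        · simpa [hb] using hlu b) hL rfl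
      exact ⟨f, hf, fun b => ⟨(hl b).trans (hb b).1, (hb b).2⟩⟩
    by_cases hR : ∀ U, 0 ≤ cutSlack src tgt l (Function.update u a (u a - 1)) U
    · have hu : ∀ b, Function.update u a (u a - 1) b ≤ u b := fun b => by
        rcases eq_or_ne b a with rfl | hb <;> simp [*]
      have hsum : ∑ b, (Function.update u a (u a - 1) b - l b) < ∑ b, (u b - l b) :=
        sum_lt_sum (fun b _ => sub_le_sub_right (hu b) _) ⟨a, mem_univ a, by simp⟩
      obtain ⟨f, hf, hb⟩ := ih _ (by omega) l (Function.update u a (u a - 1)) (fun b => by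
        rcases eq_or_ne b a with rfl | hb
        · simpa using Int.le_sub_one_of_lt ha
        · simpa [hb] using hlu b) hR rfl
      exact ⟨f, hf, fun b => ⟨(hb b).1, (hb b).2.trans (hu b)⟩⟩
    push Not at hL hR
    obtain ⟨U, hU⟩ := hL
    obtain ⟨W, hW⟩ := hR
    rw [cutSlack_update_lower] at hU
    rw [cutSlack_update_upper] at hW
    have hU0 := hcut U
    have hW0 := hcut W
    split_ifs at hU hW with hUa hWa
    all_goals try omega
    have hlt := cutSlack_inter_add_union_lt src tgt hlu ha hUa hWa
    have := hcut (U ∩ W)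
    have := hcut (U ∪ W)
    omega

lemma card_cutEdges {V A : Type*} [DecidableEq V] [Fintype A] [DecidableEq A]
    (src tgt : A → V) (U : Finset V) :
    (cutEdges src tgt U).card = (outArcs src tgt U).card + (inArcs src tgt U).card := by
  refine card_union_of_disjoint (disjoint_left.mpr fun a ha hb => ?_)
  simp only [outArcs, inArcs, mem_filter] at ha hb
  exact hb.2.2 ha.2.1

/-- Jaeger's lemma: an orientation (given by the arcs `A` with endpoint maps `src`, `tgt`)
admits a nowhere-zero circular `k`-flow, i.e. a circulation `f` with `1 ≤ f_e ≤ k - 1` on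
every arc, if and only if it is `k`-cut-balanced. -/
theorem nzflow_iff_cut_balanced (src tgt : A → V) (k : ℚ) (hk : 2 ≤ k) :
    (∃ f : A → ℚ,
      (∀ v : V, ∑ a ∈ univ.filter (fun a => src a = v), f a
              = ∑ a ∈ univ.filter (fun a => tgt a = v), f a) ∧
      ∀ a : A, 1 ≤ f a ∧ f a ≤ k - 1)
    ↔
    (∀ U : Finset V, U.Nonempty → U ≠ univ →
      ((cutEdges src tgt U).card : ℚ) / k ≤ ((outArcs src tgt U).card : ℚ) ∧
      ((outArcs src tgt U).card : ℚ) ≤ (k - 1) / k * ((cutEdges src tgt U).card : ℚ)) := by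
  have hk0 : 0 < k := by linarith
  constructor
  · rintro ⟨f, hf, hb⟩ U - -
    have hzero := sum_outArcs_sub_sum_inArcs src tgt f U
    rw [sum_eq_zero fun v _ => sub_eq_zero.mpr (hf v), sub_eq_zero] at hzero
    have hlower : ∀ s : Finset A, (s.card : ℚ) ≤ ∑ a ∈ s, f a := fun s => by
      simpa using card_nsmul_le_sum s f 1 fun a _ => (hb a).1
    have hupper : ∀ s : Finset A, ∑ a ∈ s, f a ≤ s.card * (k - 1) := fun s => by
      simpa using sum_le_card_nsmul s f (k - 1) fun a _ => (hb a).2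
    have h1 := hlower (outArcs src tgt U)
    have h2 := hupper (outArcs src tgt U)
    have h3 := hlower (inArcs src tgt U)
    have h4 := hupper (inArcs src tgt U)
    rw [card_cutEdges, Nat.cast_add, div_mul_eq_mul_div, div_le_iff₀ hk0, le_div_iff₀ hk0]
    constructor <;> linarith
  · intro h
    have hden : (0 : ℚ) < k.den := by exact_mod_cast k.den_pos
    have hnum : (k.num : ℚ) = k * k.den := (Rat.mul_den_eq_num k).symm
    obtain ⟨f, hf, hb⟩ := exists_circulation_of_cutSlack_nonneg src tgt
      (fun _ => (k.den : ℤ)) (fun _ => k.num - k.den)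
      (fun _ => by
        have : (k.den : ℚ) ≤ k.num - k.den := by rw [hnum]; nlinarith
        exact_mod_cast this)
      (fun U => by
        rcases U.eq_empty_or_nonempty with rfl | hne
        · simp [cutSlack]
        by_cases huniv : U = univ
        · simp [huniv, cutSlack]
        have hU := (h U hne huniv).1
        rw [card_cutEdges, Nat.cast_add, div_le_iff₀ hk0] at hU
        have : (0 : ℚ) ≤ (outArcs src tgt U).card * (k.num - k.den)
            - (inArcs src tgt U).card * k.den := by
          rw [hnum]; nlinarith
        rw [cutSlack_eq, sum_const, sum_const, nsmul_eq_mul, nsmul_eq_mul]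
        exact_mod_cast this)
    refine ⟨fun a => f a / k.den, fun v => ?_, fun a => ?_⟩
    · rw [← sum_div, ← sum_div]
      congr 1
      exact_mod_cast hf v
    · have h1 : (k.den : ℚ) ≤ f a := by exact_mod_cast (hb a).1
      have h2 : (f a : ℚ) ≤ k.num - k.den := by exact_mod_cast (hb a).2
      rw [le_div_iff₀ hden, div_le_iff₀ hden]
      constructor <;> linarith
end

section
/- If a digraph D has minimum dicut size τ and its underlying undirected graph admits a nowhere-zero circular k-flow for some rational k ≥ 2, then D contains ⌊τ/k⌋ pairwise arc-disjoint dijoins. -/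
open Finset

variable {V A : Type*} [Fintype V] [DecidableEq V] [Fintype A] [DecidableEq A]

/-- `U` induces a dicut: nonempty, proper, no entering arcs (the dicut is `outArcs U`). -/
def IsDicut (src tgt : A → V) (U : Finset V) : Prop :=
  U.Nonempty ∧ U ≠ univ ∧ inArcs src tgt U = ∅

/-- A dijoin: an arc set meeting every dicut. -/
def IsDijoin (src tgt : A → V) (J : Finset A) : Prop :=
  ∀ U : Finset V, IsDicut src tgt U → (outArcs src tgt U ∩ J).Nonempty

/-- Tail of an arc under the orientation `o` of the underlying undirected graph. -/
def otail (src tgt : A → V) (o : A → Bool) (a : A) : V := if o a then src a else tgt a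

/-- Head of an arc under the orientation `o` of the underlying undirected graph. -/
def ohead (src tgt : A → V) (o : A → Bool) (a : A) : V := if o a then tgt a else src a

/-- The underlying undirected graph admits a nowhere-zero circular `k`-flow: an orientation
`o` of the edges together with a circulation `f` with `1 ≤ f_e ≤ k - 1` everywhere. -/
def HasNZCircularFlow (src tgt : A → V) (k : ℚ) : Prop :=
  ∃ (o : A → Bool) (f : A → ℚ),
    (∀ v : V, ∑ a ∈ univ.filter (fun a => otail src tgt o a = v), f a
            = ∑ a ∈ univ.filter (fun a => ohead src tgt o a = v), f a) ∧
    ∀ a : A, 1 ≤ f a ∧ f a ≤ k - 1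

/-- Submodularity of the number of arcs of `C` entering a vertex set. -/
lemma card_inter_inArcs_inter_add_union_le {W : Type*} [DecidableEq W] (src tgt : A → W) (C : Finset A)
    (X Y : Finset W) :
    (C ∩ inArcs src tgt (X ∩ Y)).card + (C ∩ inArcs src tgt (X ∪ Y)).card
      ≤ (C ∩ inArcs src tgt X).card + (C ∩ inArcs src tgt Y).card := by
  simp only [inArcs, inter_filter, inter_univ, card_filter, ← sum_add_distrib]
  refine sum_le_sum fun a _ => ?_
  by_cases h1 : tgt a ∈ X <;> by_cases h2 : tgt a ∈ Y <;> by_cases h3 : src a ∈ X <;>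
    by_cases h4 : src a ∈ Y <;> simp [h1, h2, h3, h4]

/-- If every member of a family closed under unions and nonempty intersections is entered by at
least `p + 1` arcs of `B`, then some `J ⊆ B` enters every member while `B \ J` still enters every
member at least `p` times. -/
lemma exists_cover_of_succ_le_card (src tgt : A → V) (F : Set (Finset V))
    (hunion : ∀ X ∈ F, ∀ Y ∈ F, X ∪ Y ∈ F)
    (hinter : ∀ X ∈ F, ∀ Y ∈ F, (X ∩ Y).Nonempty → X ∩ Y ∈ F) (B : Finset A) (p : ℕ)
    (hB : ∀ X ∈ F, p + 1 ≤ (B ∩ inArcs src tgt X).card) :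
    ∃ J ⊆ B, (∀ X ∈ F, (J ∩ inArcs src tgt X).Nonempty) ∧
      ∀ X ∈ F, p ≤ ((B \ J) ∩ inArcs src tgt X).card := by
  classical
  let P : Finset A → Prop := fun J => J ⊆ B ∧
    (∀ X ∈ F, p ≤ ((B \ J) ∩ inArcs src tgt X).card) ∧
    ∀ X ∈ F, J ∩ inArcs src tgt X = ∅ → ∀ j ∈ J, tgt j ∉ X
  have hP0 : P ∅ := ⟨by simp, fun X hX => by simpa using (Nat.le_succ p).trans (hB X hX), by simp⟩
  obtain ⟨J, hJ⟩ := (Set.toFinite {J | P J}).exists_maximal ⟨∅, hP0⟩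
  obtain ⟨⟨hJB, hslack, hheads⟩, hmax⟩ := hJ
  refine ⟨J, hJB, ?_, hslack⟩
  by_contra! hcon
  obtain ⟨U₀, hU₀, hU₀J⟩ := hcon
  obtain ⟨U, ⟨⟨hU, hUJ⟩, hUmax⟩⟩ :=
    (Set.toFinite {X | X ∈ F ∧ J ∩ inArcs src tgt X = ∅}).exists_maximal ⟨U₀, hU₀, hU₀J⟩
  have hsub : ∀ X ∈ F, J ∩ inArcs src tgt X = ∅ → X ⊆ U := by
    intro X hX hXJ
    refine subset_union_left.trans (hUmax (y := X ∪ U) ⟨hunion X hX U hU, ?_⟩ subset_union_right)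
    refine eq_empty_of_forall_notMem fun a ha => ?_
    simp only [inArcs, mem_inter, mem_filter, mem_univ, true_and, mem_union, not_or] at ha
    obtain ⟨haJ, h | h, -, -⟩ := ha
    · exact hheads X hX hXJ a haJ h
    · exact hheads U hU hUJ a haJ h
  have hfull : ∀ X ∈ F, X ⊆ U → p + 1 ≤ ((B \ J) ∩ inArcs src tgt X).card := by
    intro X hX hXU
    refine (hB X hX).trans (card_le_card fun a ha => ?_)
    simp only [inArcs, mem_inter, mem_sdiff, mem_filter, mem_univ, true_and] at ha ⊢
    exact ⟨⟨ha.1, fun haJ => hheads U hU hUJ a haJ (hXU ha.2.1)⟩, ha.2⟩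
  obtain ⟨b, hbB, hbh, hbt, hb⟩ : ∃ b ∈ B \ J, tgt b ∈ U ∧ src b ∉ U ∧
      ∀ X ∈ F, b ∈ inArcs src tgt X → p + 1 ≤ ((B \ J) ∩ inArcs src tgt X).card := by
    by_cases htight : ∃ X ∈ F, (X ∩ U).Nonempty ∧ ((B \ J) ∩ inArcs src tgt X).card = p
    · obtain ⟨X₀, hX₀⟩ := htight
      obtain ⟨X, ⟨⟨hX, hXU, hXp⟩, hXmin⟩⟩ := (Set.toFinite {X | X ∈ F ∧ (X ∩ U).Nonempty ∧
        ((B \ J) ∩ inArcs src tgt X).card = p}).exists_minimal ⟨X₀, hX₀⟩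
      have hlt : ((B \ J) ∩ inArcs src tgt X).card <
          ((B \ J) ∩ inArcs src tgt (X ∩ U)).card := by
        have := hfull _ (hinter X hX U hU hXU) inter_subset_right
        omega
      obtain ⟨b, hb, hbX⟩ := exists_mem_notMem_of_card_lt_card hlt
      simp only [inArcs, mem_inter, mem_filter, mem_univ, true_and] at hb hbX
      have hbsX : src b ∈ X := by tauto
      refine ⟨b, hb.1, hb.2.1.2, by tauto, fun Y hY hbY => ?_⟩
      by_contra! hYp
      simp only [inArcs, mem_filter, mem_univ, true_and] at hbY
      have hXY : X ∩ Y ∈ F := hinter X hX Y hY ⟨tgt b, mem_inter.2 ⟨hb.2.1.1, hbY.1⟩⟩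
      have h1 := card_inter_inArcs_inter_add_union_le src tgt (B \ J) X Y
      have h2 := hslack _ hXY
      have h3 := hslack _ (hunion X hX Y hY)
      have hle : X ⊆ X ∩ Y := hXmin (y := X ∩ Y) ⟨hXY, ⟨tgt b, by simp [hb.2.1, hbY.1]⟩, by omega⟩
        inter_subset_left
      exact hbY.2 (mem_inter.1 (hle hbsX)).2
    · push Not at htight
      obtain ⟨b, hb⟩ := card_pos.1 ((Nat.succ_pos p).trans_le (hfull U hU subset_rfl))
      simp only [inArcs, mem_inter, mem_filter, mem_univ, true_and] at hb
      refine ⟨b, hb.1, hb.2.1, hb.2.2, fun X hX hbX => ?_⟩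
      simp only [inArcs, mem_filter, mem_univ, true_and] at hbX
      exact Nat.succ_le_of_lt
        (lt_of_le_of_ne (hslack X hX) (htight X hX ⟨tgt b, by simp [hbX.1, hb.2.1]⟩).symm)
  have hbJ := (mem_sdiff.1 hbB).2
  have hPb : P (insert b J) := by
    refine ⟨insert_subset (mem_sdiff.1 hbB).1 hJB, fun X hX => ?_, fun X hX hXJ => ?_⟩
    · rw [sdiff_insert, erase_inter]
      by_cases hbX : b ∈ inArcs src tgt X
      · have := hb X hX hbX
        have := pred_card_le_card_erase (s := (B \ J) ∩ inArcs src tgt X) (a := b)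
        omega
      · rw [erase_eq_of_notMem (by simp [hbX])]
        exact hslack X hX
    · have hXJ' : J ∩ inArcs src tgt X = ∅ :=
        subset_empty.1 (hXJ ▸ inter_subset_inter_right (subset_insert b J))
      intro j hj hjX
      rcases mem_insert.1 hj with rfl | hj
      · have : j ∈ insert j J ∩ inArcs src tgt X := by
          simp only [inArcs, mem_inter, mem_insert_self, mem_filter, mem_univ, true_and]
          exact ⟨hjX, fun h => hbt (hsub X hX hXJ' h)⟩
        simp [hXJ] at this
      · exact hheads X hX hXJ' j hj hjX
  exact hbJ (hmax hPb (subset_insert b J) (mem_insert_self b J))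

/-- Frank's generalization of Edmonds' disjoint arborescences theorem: if every member of a family
closed under unions and nonempty intersections is entered by at least `p` arcs of `B`, then `B`
contains `p` disjoint arc sets, each entering every member. -/
lemma exists_disjoint_covers (src tgt : A → V) (F : Set (Finset V))
    (hunion : ∀ X ∈ F, ∀ Y ∈ F, X ∪ Y ∈ F)
    (hinter : ∀ X ∈ F, ∀ Y ∈ F, (X ∩ Y).Nonempty → X ∩ Y ∈ F) (p : ℕ) (B : Finset A)
    (hB : ∀ X ∈ F, p ≤ (B ∩ inArcs src tgt X).card) :
    ∃ J : Fin p → Finset A, (∀ i, J i ⊆ B) ∧ (∀ i j, i ≠ j → Disjoint (J i) (J j)) ∧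
      ∀ i, ∀ X ∈ F, (J i ∩ inArcs src tgt X).Nonempty := by
  induction p generalizing B with
  | zero => exact ⟨fun _ => ∅, fun i => i.elim0, fun i => i.elim0, fun i => i.elim0⟩
  | succ p ih =>
    obtain ⟨J₀, hJ₀B, hJ₀, hrest⟩ := exists_cover_of_succ_le_card src tgt F hunion hinter B p hB
    obtain ⟨J, hJB, hdisj, hJ⟩ := ih (B \ J₀) hrest
    refine ⟨Fin.cons J₀ J, ?_, ?_, ?_⟩
    · exact Fin.cases hJ₀B fun i => (hJB i).trans sdiff_subset
    · have h0 : ∀ i, Disjoint J₀ (J i) := fun i => disjoint_sdiff.mono_right (hJB i)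
      refine Fin.cases (Fin.cases (by simp) fun j _ => ?_)
        fun i => Fin.cases (fun _ => ?_) fun j hij => ?_
      · simpa using h0 j
      · simpa using (h0 i).symm
      · simpa using hdisj i j (by simpa using hij)
    · exact Fin.cases hJ₀ hJ

/-- The covering theorem for the nonempty vertex sets avoiding a root `r` that no arc leaves. -/
lemma exists_disjoint_rooted_covers (src tgt : A → V) (r : V) (p : ℕ) (B : Finset A)
    (hB : ∀ X : Finset V, X.Nonempty → r ∉ X → outArcs src tgt X = ∅ →
      p ≤ (B ∩ inArcs src tgt X).card) :
    ∃ J : Fin p → Finset A, (∀ i, J i ⊆ B) ∧ (∀ i j, i ≠ j → Disjoint (J i) (J j)) ∧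
      ∀ i, ∀ X : Finset V, X.Nonempty → r ∉ X → outArcs src tgt X = ∅ →
        (J i ∩ inArcs src tgt X).Nonempty := by
  refine (exists_disjoint_covers src tgt {X | X.Nonempty ∧ r ∉ X ∧ outArcs src tgt X = ∅} ?_ ?_ p B
    fun X hX => hB X hX.1 hX.2.1 hX.2.2).imp
      fun J hJ => ⟨hJ.1, hJ.2.1, fun i X h1 h2 h3 => hJ.2.2 i X ⟨h1, h2, h3⟩⟩
  · rintro X ⟨hX, hrX, hoX⟩ Y ⟨-, hrY, hoY⟩
    refine ⟨hX.mono subset_union_left, by simp [hrX, hrY], ?_⟩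
    simp only [outArcs, filter_eq_empty_iff, mem_univ, true_imp_iff, mem_union] at hoX hoY ⊢
    intro a
    have := @hoX a
    have := @hoY a
    tauto
  · rintro X ⟨-, hrX, hoX⟩ Y ⟨-, hrY, hoY⟩ hne
    refine ⟨hne, by simp [hrX], ?_⟩
    simp only [outArcs, filter_eq_empty_iff, mem_univ, true_imp_iff, mem_inter] at hoX hoY ⊢
    intro a
    have := @hoX a
    have := @hoY a
    tauto

/-- Across a dicut, a circulation carries as much along the arcs it follows as along those it
reverses. -/
lemma sum_dicut_forward_eq_backward {W : Type*} [DecidableEq W] (src tgt : A → W)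
    (o : A → Bool) (f : A → ℚ)
    (hf : ∀ v : W, ∑ a ∈ univ.filter (fun a => otail src tgt o a = v), f a
      = ∑ a ∈ univ.filter (fun a => ohead src tgt o a = v), f a)
    (U : Finset W) (hU : inArcs src tgt U = ∅) :
    ∑ a ∈ univ.filter (fun a => o a = true) ∩ outArcs src tgt U, f a
      = ∑ a ∈ univ.filter (fun a => o a = false) ∩ outArcs src tgt U, f a := by
  have key : ∑ a ∈ univ.filter (fun a => otail src tgt o a ∈ U), f a
      = ∑ a ∈ univ.filter (fun a => ohead src tgt o a ∈ U), f a := by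
    have := sum_congr (rfl : U = U) fun v _ => hf v
    rwa [sum_fiberwise_eq_sum_filter, sum_fiberwise_eq_sum_filter] at this
  simp only [inArcs, filter_eq_empty_iff, mem_univ, true_imp_iff] at hU
  simp only [outArcs, filter_inter, univ_inter, filter_filter, sum_filter] at key ⊢
  rw [← sub_eq_zero, ← sum_sub_distrib] at key ⊢
  rw [← key]
  refine sum_congr rfl fun a _ => ?_
  have := @hU a
  by_cases h1 : src a ∈ U <;> by_cases h2 : tgt a ∈ U <;> cases ho : o a <;>
    simp_all [otail, ohead]

/-- If two disjoint arc sets carry the same total of a function with values in `[1, k - 1]`, the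
first contains at least a `1 / k` fraction of the arcs. -/
lemma card_add_card_le_mul_card_of_sum_eq {E : Type*} (f : E → ℚ) (k : ℚ)
    (hf : ∀ a, 1 ≤ f a ∧ f a ≤ k - 1) (S T : Finset E) (h : ∑ a ∈ S, f a = ∑ a ∈ T, f a) :
    (S.card : ℚ) + T.card ≤ S.card * k := by
  have h1 : ∑ a ∈ S, f a ≤ S.card * (k - 1) := by
    simpa using sum_le_card_nsmul S f (k - 1) fun a _ => (hf a).2
  have h2 : (T.card : ℚ) ≤ ∑ a ∈ T, f a := by
    simpa using card_nsmul_le_sum T f 1 fun a _ => (hf a).1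
  linarith

/-- A circular `k`-flow splits every dicut into two parts, each of size at least `⌊τ / k⌋`. -/
lemma floor_le_card_of_orientation {W : Type*} [DecidableEq W] (src tgt : A → W)
    (τ : ℕ) (k : ℚ) (hk : 0 < k) (o : A → Bool) (f : A → ℚ)
    (hf : ∀ v : W, ∑ a ∈ univ.filter (fun a => otail src tgt o a = v), f a
      = ∑ a ∈ univ.filter (fun a => ohead src tgt o a = v), f a)
    (hbd : ∀ a, 1 ≤ f a ∧ f a ≤ k - 1) (U : Finset W) (hU : inArcs src tgt U = ∅)
    (hτ : τ ≤ (outArcs src tgt U).card) (c : Bool) :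
    ⌊(τ : ℚ) / k⌋.toNat ≤ (univ.filter (fun a => o a = c) ∩ outArcs src tgt U).card := by
  have hsum := sum_dicut_forward_eq_backward src tgt o f hf U hU
  have hcard : (univ.filter (fun a => o a = true) ∩ outArcs src tgt U).card
      + (univ.filter (fun a => o a = false) ∩ outArcs src tgt U).card
      = (outArcs src tgt U).card := by
    rw [← card_filter_add_card_filter_not (s := outArcs src tgt U) (fun a => o a = true)]
    simp [filter_inter]
  have hle : ((outArcs src tgt U).card : ℚ)
      ≤ (univ.filter (fun a => o a = c) ∩ outArcs src tgt U).card * k := by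
    rw [← hcard, Nat.cast_add]
    cases c
    · rw [add_comm]
      exact card_add_card_le_mul_card_of_sum_eq f k hbd _ _ hsum.symm
    · exact card_add_card_le_mul_card_of_sum_eq f k hbd _ _ hsum
  rw [Int.toNat_le]
  have hτ' : (τ : ℚ) ≤ (outArcs src tgt U).card := by exact_mod_cast hτ
  have := (Int.floor_le ((τ : ℚ) / k)).trans ((div_le_iff₀ hk).2 (hτ'.trans hle))
  exact_mod_cast this

/-- If `D` has minimum dicut size `τ` and its underlying undirected graph admits a nowhere-zero
circular `k`-flow for some rational `k ≥ 2`, then `D` contains `⌊τ/k⌋` pairwise disjoint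
dijoins. -/
theorem pack_dijoins_via_flow (src tgt : A → V) (τ : ℕ) (k : ℚ) (hk : 2 ≤ k)
    (hmin : ∀ U : Finset V, IsDicut src tgt U → τ ≤ (outArcs src tgt U).card)
    (hflow : HasNZCircularFlow src tgt k) :
    ∃ J : Fin (⌊(τ : ℚ) / k⌋.toNat) → Finset A,
      (∀ i j, i ≠ j → Disjoint (J i) (J j)) ∧ ∀ i, IsDijoin src tgt (J i) := by
  obtain ⟨o, f, hf, hbd⟩ := hflow
  have hsplit := fun (U : Finset V) (hU : IsDicut src tgt U) =>
    floor_le_card_of_orientation src tgt τ k (by linarith) o f hf hbd U hU.2.2 (hmin U hU)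
  generalize ⌊(τ : ℚ) / k⌋.toNat = p at hsplit ⊢
  have hcompl : ∀ X : Finset V, inArcs src tgt Xᶜ = outArcs src tgt X ∧
      outArcs src tgt Xᶜ = inArcs src tgt X := by
    intro X
    simp [inArcs, outArcs, and_comm]
  rcases isEmpty_or_nonempty V with hV | ⟨⟨r⟩⟩
  · exact ⟨fun _ => ∅, by simp, fun i U hU => hV.elim hU.1.choose⟩
  obtain ⟨J₁, hJ₁, hd₁, hc₁⟩ := exists_disjoint_rooted_covers src tgt r p
    (univ.filter fun a => o a = true) fun X hX hr ho => by
      rw [← (hcompl X).2]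
      refine hsplit Xᶜ ⟨⟨r, by simpa using hr⟩, ?_, (hcompl X).1.trans ho⟩ true
      simpa using hX.ne_empty
  obtain ⟨J₂, hJ₂, hd₂, hc₂⟩ := exists_disjoint_rooted_covers tgt src r p
    (univ.filter fun a => o a = false) fun X hX hr ho =>
      hsplit X ⟨hX, fun h => hr (h ▸ mem_univ r), ho⟩ false
  have hdisj : Disjoint (univ.filter fun a => o a = true) (univ.filter fun a => o a = false) :=
    disjoint_filter.2 fun a _ h => by simp [h]
  refine ⟨fun i => J₁ i ∪ J₂ i, fun i j hij => ?_, fun i U hU => ?_⟩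
  · simp only [disjoint_union_left, disjoint_union_right]
    exact ⟨⟨hd₁ i j hij, (hdisj.mono (hJ₁ j) (hJ₂ i)).symm⟩,
      hdisj.mono (hJ₁ i) (hJ₂ j), hd₂ i j hij⟩
  · rw [inter_comm]
    by_cases hr : r ∈ U
    · have h := hc₁ i Uᶜ (by simpa [nonempty_iff_ne_empty] using hU.2.1) (by simpa using hr)
        ((hcompl U).2.trans hU.2.2)
      rw [(hcompl U).1] at h
      exact h.mono (inter_subset_inter_right subset_union_left)
    · exact (hc₂ i U hU.1 hr hU.2.2).mono (inter_subset_inter_right subset_union_right)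
end

section
/- Every digraph with minimum dicut size τ contains ⌊τ/6⌋ pairwise arc-disjoint dijoins. -/
open Finset

variable {V A : Type*} [Fintype V] [DecidableEq V] [Fintype A] [DecidableEq A]

set_option linter.unusedSectionVars false

section Branching

/-- The number of arcs of `E` entering a vertex set is submodular. -/
lemma card_inter_inArcs_submodular (src tgt : A → V) (E : Finset A) (X Y : Finset V) :
    #(E ∩ inArcs src tgt (X ∩ Y)) + #(E ∩ inArcs src tgt (X ∪ Y)) ≤
      #(E ∩ inArcs src tgt X) + #(E ∩ inArcs src tgt Y) := by
  have key : ∀ U : Finset V, #(E ∩ inArcs src tgt U) =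
      ∑ a ∈ E, if tgt a ∈ U ∧ src a ∉ U then 1 else 0 := by
    intro U
    rw [← Finset.card_filter]
    congr 1
    ext a
    simp [inArcs]
  simp only [key, ← Finset.sum_add_distrib]
  refine Finset.sum_le_sum fun a _ => ?_
  simp only [mem_inter, mem_union]
  by_cases h1 : tgt a ∈ X <;> by_cases h2 : tgt a ∈ Y <;> by_cases h3 : src a ∈ X <;>
    by_cases h4 : src a ∈ Y <;> simp [h1, h2, h3, h4]

/-- If every nonempty vertex set avoiding `r` is entered by at least `k + 1` arcs of `E`, then some
`T ⊆ E` enters every such set while `E \ T` still has at least `k` arcs entering each of them. -/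
lemma exists_spanning_branching (src tgt : A → V) (r : V) (k : ℕ) (E : Finset A)
    (hE : ∀ U : Finset V, U.Nonempty → r ∉ U → k + 1 ≤ #(E ∩ inArcs src tgt U)) :
    ∃ T ⊆ E, (∀ U : Finset V, U.Nonempty → r ∉ U → (T ∩ inArcs src tgt U).Nonempty) ∧
      ∀ U : Finset V, U.Nonempty → r ∉ U → k ≤ #((E \ T) ∩ inArcs src tgt U) := by
  classical
  let I : Finset V → Prop := fun S => r ∈ S ∧ ∃ T ⊆ E, (∀ a ∈ T, tgt a ∈ S) ∧
    (∀ U : Finset V, (U ∩ S).Nonempty → r ∉ U → (T ∩ inArcs src tgt U).Nonempty) ∧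
    ∀ U : Finset V, U.Nonempty → r ∉ U → k ≤ #((E \ T) ∩ inArcs src tgt U)
  have h0 : I {r} := by
    refine ⟨by simp, ∅, by simp, by simp, ?_, ?_⟩
    · rintro U ⟨v, hv⟩ hr
      simp only [mem_inter, mem_singleton] at hv
      exact absurd (hv.2 ▸ hv.1) hr
    · intro U hU hr
      have := hE U hU hr
      simp only [sdiff_empty]
      omega
  obtain ⟨S, hS⟩ := (Set.toFinite {S | I S}).exists_maximal ⟨_, h0⟩
  obtain ⟨⟨hrS, T, hTE, hTS, hTc, hTk⟩, hmax⟩ := hS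
  by_cases hSu : S = univ
  · subst hSu
    exact ⟨T, hTE, fun U hU hr => hTc U (by simpa using hU) hr, hTk⟩
  exfalso
  let C : Finset V → Prop := fun X =>
    r ∉ X ∧ (∃ v ∈ X, v ∉ S) ∧ #((E \ T) ∩ inArcs src tgt X) = k
  have hlarge : ∀ X : Finset V, X.Nonempty → r ∉ X → Disjoint X S →
      k + 1 ≤ #((E \ T) ∩ inArcs src tgt X) := by
    intro X hX hr hd
    refine (hE X hX hr).trans (card_le_card fun a ha => ?_)
    simp only [mem_inter, mem_sdiff] at ha ⊢
    refine ⟨⟨ha.1, fun haT => ?_⟩, ha.2⟩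
    have h1 := hTS a haT
    have h2 : tgt a ∈ X := by
      have := ha.2
      simp only [inArcs, mem_filter] at this
      exact this.2.1
    exact Finset.disjoint_left.1 hd h2 h1
  have harc : ∃ a ∈ E \ T, src a ∈ S ∧ tgt a ∉ S ∧ ∀ Y, C Y → a ∉ inArcs src tgt Y := by
    by_cases hC : ∃ X, C X
    · obtain ⟨X, hX⟩ := (Set.toFinite {X | C X}).exists_minimal hC
      obtain ⟨⟨hrX, ⟨v, hvX, hvS⟩, hXk⟩, hmin⟩ := hX
      have h1 := hlarge (X \ S) ⟨v, by simp [hvX, hvS]⟩ (by simp [hrX]) Finset.sdiff_disjoint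
      obtain ⟨a, ha, ha'⟩ := Finset.exists_mem_notMem_of_card_lt_card (lt_of_lt_of_le
        (by omega : #((E \ T) ∩ inArcs src tgt X) < k + 1) h1)
      simp only [inArcs, mem_inter, mem_filter, mem_univ, true_and, mem_sdiff] at ha ha'
      have hsX : src a ∈ X := by tauto
      have hsS : src a ∈ S := by tauto
      refine ⟨a, by simpa using ha.1, hsS, ha.2.1.2, fun Y hY haY => ?_⟩
      obtain ⟨hrY, -, hYk⟩ := hY
      simp only [inArcs, mem_filter, mem_univ, true_and] at haY
      have hsub := card_inter_inArcs_submodular src tgt (E \ T) X Y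
      have h2 := hTk (X ∩ Y) ⟨tgt a, by simp [haY.1, ha.2.1.1]⟩ (by simp [hrX])
      have h3 := hTk (X ∪ Y) ⟨tgt a, by simp [haY.1]⟩ (by simp [hrX, hrY])
      have h4 : C (X ∩ Y) := ⟨by simp [hrX], ⟨tgt a, by simp [haY.1, ha.2.1.1], ha.2.1.2⟩, by omega⟩
      have h5 := hmin h4 Finset.inter_subset_left
      exact haY.2 (Finset.mem_inter.1 (h5 hsX)).2
    · have h1 := hlarge Sᶜ (by
        rw [Finset.nonempty_iff_ne_empty]; simpa using hSu) (by simpa using hrS)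
        disjoint_compl_left
      obtain ⟨a, ha⟩ := Finset.card_pos.1 (by omega : 0 < #((E \ T) ∩ inArcs src tgt Sᶜ))
      simp only [inArcs, mem_inter, mem_filter, mem_univ, true_and, mem_compl, not_not] at ha
      exact ⟨a, ha.1, ha.2.2, ha.2.1, fun Y hY => absurd ⟨Y, hY⟩ hC⟩
  obtain ⟨a, haE, hsS, htS, haC⟩ := harc
  have hnew : I (insert (tgt a) S) := by
    refine ⟨by simp [hrS], insert a T, ?_, ?_, ?_, ?_⟩
    · exact Finset.insert_subset (Finset.mem_sdiff.1 haE).1 hTE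
    · intro b hb
      rcases Finset.mem_insert.1 hb with rfl | hb
      · simp
      · exact Finset.mem_insert_of_mem (hTS b hb)
    · rintro U ⟨v, hv⟩ hr
      by_cases hUS : (U ∩ S).Nonempty
      · exact (hTc U hUS hr).mono (Finset.inter_subset_inter_right (Finset.subset_insert _ _))
      · rw [Finset.not_nonempty_iff_eq_empty] at hUS
        have hdis : ∀ w ∈ U, w ∉ S := fun w hw hw' => by
          have : w ∈ U ∩ S := Finset.mem_inter.2 ⟨hw, hw'⟩
          simp [hUS] at this
        simp only [mem_inter, mem_insert] at hv
        refine ⟨a, ?_⟩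
        simp only [inArcs, mem_inter, mem_filter, mem_univ, true_and, mem_insert, true_or]
        refine ⟨?_, fun h => hdis _ h hsS⟩
        rcases hv.2 with h | h
        · exact h ▸ hv.1
        · exact absurd h (hdis _ hv.1)
    · intro U hU hr
      have heq : (E \ insert a T) ∩ inArcs src tgt U = ((E \ T) ∩ inArcs src tgt U).erase a := by
        ext b
        simp only [mem_inter, mem_sdiff, mem_insert, mem_erase]
        tauto
      rw [heq]
      by_cases haU : a ∈ inArcs src tgt U
      · have h1 := hTk U hU hr
        have h2 : #((E \ T) ∩ inArcs src tgt U) ≠ k := fun h => haC U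
          ⟨hr, ⟨tgt a, by simp only [inArcs, mem_filter] at haU; exact haU.2.1, htS⟩, h⟩ haU
        rw [Finset.card_erase_of_mem (Finset.mem_inter.2 ⟨haE, haU⟩)]
        omega
      · rw [Finset.erase_eq_of_notMem (by simp [haU])]
        exact hTk U hU hr
  exact htS (hmax hnew (Finset.subset_insert _ _) (Finset.mem_insert_self _ _))

/-- Edmonds' theorem on disjoint branchings, phrased through the sets that they enter. -/
lemma exists_disjoint_branchings (src tgt : A → V) (r : V) (k : ℕ) (E : Finset A)
    (hE : ∀ U : Finset V, U.Nonempty → r ∉ U → k ≤ #(E ∩ inArcs src tgt U)) :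
    ∃ J : Fin k → Finset A, (∀ i, J i ⊆ E) ∧ (∀ i j, i ≠ j → Disjoint (J i) (J j)) ∧
      ∀ i, ∀ U : Finset V, U.Nonempty → r ∉ U → (J i ∩ inArcs src tgt U).Nonempty := by
  induction k generalizing E with
  | zero => exact ⟨fun _ => ∅, by simp, fun i => i.elim0, fun i => i.elim0⟩
  | succ k ih =>
    obtain ⟨T, hTE, hTc, hTk⟩ := exists_spanning_branching src tgt r k E hE
    obtain ⟨J, hJE, hJd, hJc⟩ := ih (E \ T) hTk
    have hdT : ∀ i, Disjoint T (J i) := fun i => disjoint_sdiff.mono_right (hJE i)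
    refine ⟨Fin.cons T J, fun i => ?_, fun i j => ?_, fun i => ?_⟩
    · refine Fin.cases hTE (fun i => (hJE i).trans sdiff_subset) i
    · refine Fin.cases (Fin.cases (by simp) (fun j _ => ?_) j) (fun i => Fin.cases (fun _ => ?_)
        (fun j hij => ?_) j) i
      · simpa using hdT j
      · simpa using (hdT i).symm
      · simpa using hJd i j (by simpa using hij)
    · refine Fin.cases hTc (fun i => hJc i) i

/-- Arcs covering each dicut that avoids `r` at least `k` times split into `k` sets each of which
covers every such dicut. -/
lemma exists_disjoint_dicut_covers (src tgt : A → V) (r : V) (k : ℕ) (P : Finset A)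
    (hP : ∀ U : Finset V, IsDicut src tgt U → r ∉ U → k ≤ #(outArcs src tgt U ∩ P)) :
    ∃ J : Fin k → Finset A, (∀ i, J i ⊆ P) ∧ (∀ i j, i ≠ j → Disjoint (J i) (J j)) ∧
      ∀ i, ∀ U : Finset V, IsDicut src tgt U → r ∉ U → (outArcs src tgt U ∩ J i).Nonempty := by
  let s : (A × Fin k) ⊕ A → V := Sum.elim (fun p => src p.1) tgt
  let t : (A × Fin k) ⊕ A → V := Sum.elim (fun p => tgt p.1) src
  obtain ⟨J, hJP, hJd, hJc⟩ := exists_disjoint_branchings s t r k (univ.disjSum P) (by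
    intro U hU hr
    by_cases hin : inArcs src tgt U = ∅
    · refine (hP U ⟨hU, fun h => hr (h ▸ mem_univ r), hin⟩ hr).trans ?_
      rw [← Finset.card_map Function.Embedding.inr]
      refine card_le_card fun b hb => ?_
      simp only [mem_map, Function.Embedding.inr_apply, outArcs, mem_inter, mem_filter] at hb
      obtain ⟨a, ha, rfl⟩ := hb
      simp [inArcs, s, t, ha]
    · obtain ⟨a, ha⟩ := Finset.nonempty_iff_ne_empty.2 hin
      simp only [inArcs, mem_filter] at ha
      have hk : #((univ : Finset (Fin k)).image fun i => (Sum.inl (a, i) : (A × Fin k) ⊕ A)) = k := by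
        rw [Finset.card_image_of_injective _ fun i j h => by simpa using h]
        simp
      refine hk.ge.trans ?_
      refine card_le_card fun b hb => ?_
      obtain ⟨i, -, rfl⟩ := Finset.mem_image.1 hb
      simp [inArcs, s, t, ha])
  refine ⟨fun i => univ.filter fun a => Sum.inr a ∈ J i, fun i a ha => ?_, fun i j hij => ?_,
    fun i U hU hr => ?_⟩
  · have := hJP i (Finset.mem_filter.1 ha).2
    simpa using this
  · rw [Finset.disjoint_left]
    intro a hi hj
    exact Finset.disjoint_left.1 (hJd i j hij) (Finset.mem_filter.1 hi).2 (Finset.mem_filter.1 hj).2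
  · obtain ⟨b, hb⟩ := hJc i U hU.1 hr
    simp only [inArcs, mem_inter, mem_filter, mem_univ, true_and] at hb
    rcases b with p | a
    · have : p.1 ∈ inArcs src tgt U := by simpa [inArcs, s, t] using hb.2
      rw [hU.2.2] at this
      simp at this
    · exact ⟨a, by simpa [outArcs, hb.1, s, t] using hb.2⟩

end Branching

section Flow

variable {M : Type*} [AddCommGroup M]

/-- The net amount of `f` leaving each vertex. -/
def netOut (src tgt : A → V) : (A → M) →+ (V → M) where
  toFun f v := ∑ a, ((if src a = v then f a else 0) - (if tgt a = v then f a else 0))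
  map_zero' := by ext; simp
  map_add' f g := by
    ext v
    simp only [Pi.add_apply, ← Finset.sum_add_distrib]
    refine Finset.sum_congr rfl fun a _ => ?_
    split_ifs <;> abel

lemma netOut_apply (src tgt : A → V) (f : A → M) (v : V) : netOut src tgt f v =
    ∑ a, ((if src a = v then f a else 0) - (if tgt a = v then f a else 0)) := rfl

lemma netOut_single (src tgt : A → V) (a : A) (m : M) :
    netOut src tgt (Pi.single a m) = Pi.single (src a) m - Pi.single (tgt a) m := by
  ext v
  rw [netOut_apply, Finset.sum_eq_single a]
  · simp [Pi.single_apply, eq_comm]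
  · intro b _ hb
    simp [hb]
  · simp

lemma netOut_comp {N : Type*} [AddCommGroup N] (src tgt : A → V) (φ : M →+ N) (f : A → M) (v : V) :
    netOut src tgt (fun a => φ (f a)) v = φ (netOut src tgt f v) := by
  simp only [netOut_apply, map_sum, map_sub]
  refine Finset.sum_congr rfl fun a _ => ?_
  split_ifs <;> simp

lemma sum_netOut (src tgt : A → V) (f : A → M) (U : Finset V) :
    ∑ v ∈ U, netOut src tgt f v =
      ∑ a, ((if src a ∈ U then f a else 0) - (if tgt a ∈ U then f a else 0)) := by
  simp only [netOut_apply]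
  rw [Finset.sum_comm]
  refine Finset.sum_congr rfl fun a _ => ?_
  rw [Finset.sum_sub_distrib]
  simp

lemma sum_netOut_eq_cut (src tgt : A → V) (f : A → M) (U : Finset V) :
    ∑ v ∈ U, netOut src tgt f v =
      ∑ a ∈ outArcs src tgt U, f a - ∑ a ∈ inArcs src tgt U, f a := by
  rw [sum_netOut, outArcs, inArcs, Finset.sum_filter, Finset.sum_filter, ← Finset.sum_sub_distrib]
  refine Finset.sum_congr rfl fun a _ => ?_
  by_cases h1 : src a ∈ U <;> by_cases h2 : tgt a ∈ U <;> simp [h1, h2]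

/-- Residual reachability: `up` and `down` are the arcs that may be traversed forwards and
backwards. There is a set closed under such traversals, all of whose vertices are reached from `x`
by a unit flow that follows them. -/
lemma exists_reachable_set (src tgt : A → V) (up down : A → Prop) (x : V) :
    ∃ S : Finset V, x ∈ S ∧ (∀ a, up a → src a ∈ S → tgt a ∈ S) ∧
      (∀ a, down a → tgt a ∈ S → src a ∈ S) ∧
      ∀ w ∈ S, ∃ Δ : A → ℤ, netOut src tgt Δ = Pi.single x 1 - Pi.single w 1 ∧
        ∀ a, Δ a = 0 ∨ (src a ∈ S ∧ tgt a ∈ S ∧ ((up a ∧ Δ a = 1) ∨ (down a ∧ Δ a = -1))) := by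
  let I : Finset V → Prop := fun S => x ∈ S ∧
    ∀ w ∈ S, ∃ Δ : A → ℤ, netOut src tgt Δ = Pi.single x 1 - Pi.single w 1 ∧
      ∀ a, Δ a = 0 ∨ (src a ∈ S ∧ tgt a ∈ S ∧ ((up a ∧ Δ a = 1) ∨ (down a ∧ Δ a = -1)))
  have h0 : I {x} := by
    refine ⟨by simp, fun w hw => ⟨0, ?_, by simp⟩⟩
    simp only [mem_singleton] at hw
    simp [hw]
  obtain ⟨S, ⟨hxS, hS⟩, hmax⟩ := (Set.toFinite {S | I S}).exists_maximal ⟨_, h0⟩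
  have grow : ∀ (a : A) (u v : V) (e : ℤ), u ∈ S → v ∉ S →
      (src a = u ∧ tgt a = v ∧ up a ∧ e = 1 ∨ src a = v ∧ tgt a = u ∧ down a ∧ e = -1) → False := by
    intro a u v e hu hv hae
    refine hv (hmax (y := insert v S) ⟨by simp [hxS], fun w hw => ?_⟩ (Finset.subset_insert _ _)
      (Finset.mem_insert_self _ _))
    rcases Finset.mem_insert.1 hw with rfl | hw
    · obtain ⟨Δ, hΔ, hΔa⟩ := hS u hu
      have hza : Δ a = 0 := by
        rcases hΔa a with h | ⟨h1, h2, -⟩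
        · exact h
        · rcases hae with h | h
          · exact absurd (h.2.1 ▸ h2) hv
          · exact absurd (h.1 ▸ h1) hv
      refine ⟨Δ + Pi.single a e, ?_, fun b => ?_⟩
      · rw [map_add, hΔ, netOut_single]
        rcases hae with ⟨rfl, rfl, -, rfl⟩ | ⟨rfl, rfl, -, rfl⟩
        · abel
        · rw [Pi.single_neg, Pi.single_neg]; abel
      · by_cases hb : b = a
        · subst hb
          right
          rcases hae with ⟨rfl, rfl, h, rfl⟩ | ⟨rfl, rfl, h, rfl⟩ <;> simp [hza, hu, h]
        · have := hΔa b
          simp only [Pi.add_apply, Pi.single_eq_of_ne hb, add_zero, mem_insert]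
          tauto
    · obtain ⟨Δ, hΔ, hΔa⟩ := hS w hw
      refine ⟨Δ, hΔ, fun b => ?_⟩
      have := hΔa b
      simp only [mem_insert]
      tauto
  refine ⟨S, hxS, fun a ha hs => ?_, fun a ha ht => ?_, hS⟩
  · by_contra h
    exact grow a _ _ 1 hs h (Or.inl ⟨rfl, rfl, ha, rfl⟩)
  · by_contra h
    exact grow a _ _ (-1) ht h (Or.inr ⟨rfl, rfl, ha, rfl⟩)

/-- Tutte: a nowhere-zero flow modulo `k` lifts to a nowhere-zero integral `k`-flow. -/
lemma exists_int_flow_of_modular (src tgt : A → V) (k : ℕ) (hk : 0 < k) (φ : A → ZMod k)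
    (hφ : netOut src tgt φ = 0) (hnz : ∀ a, φ a ≠ 0) :
    ∃ f : A → ℤ, netOut src tgt f = 0 ∧ ∀ a, f a ≠ 0 ∧ |f a| < k := by
  have : NeZero k := ⟨hk.ne'⟩
  let P : (A → ℤ) → Prop := fun f => ∀ a, ((f a : ℤ) : ZMod k) = φ a ∧ |f a| < k
  have hne : ∃ f, P f := ⟨fun a => ((φ a).val : ℤ), fun a => ⟨by simp, by
    have := ZMod.val_lt (φ a)
    dsimp only
    rw [abs_of_nonneg (by positivity)]
    exact_mod_cast this⟩⟩
  let c : (A → ℤ) → ℕ := fun f => ∑ v, (netOut src tgt f v).natAbs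
  obtain ⟨f, hf, hmin⟩ : ∃ f, P f ∧ ∀ g, P g → c f ≤ c g := by
    obtain ⟨f, hf, h⟩ := WellFounded.has_min (measure c).wf {f | P f} hne
    exact ⟨f, hf, fun g hg => not_lt.1 (h g hg)⟩
  have hnzf : ∀ a, f a ≠ 0 := fun a h => hnz a (by rw [← (hf a).1, h]; simp)
  refine ⟨f, ?_, fun a => ⟨hnzf a, (hf a).2⟩⟩
  have hdvd : ∀ v, (k : ℤ) ∣ netOut src tgt f v := by
    intro v
    rw [← ZMod.intCast_zmod_eq_zero_iff_dvd]
    have := netOut_comp src tgt (Int.castAddHom (ZMod k)) f v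
    simp only [Int.coe_castAddHom] at this
    rw [← this, show (fun a => ((f a : ℤ) : ZMod k)) = φ from funext fun a => (hf a).1, hφ]
    rfl
  have hnonpos : ∀ x, netOut src tgt f x ≤ 0 := by
    intro x
    by_contra hx
    push Not at hx
    obtain ⟨S, hxS, hup, hdown, hS⟩ := exists_reachable_set src tgt (fun a => 0 < f a)
      (fun a => f a < 0) x
    have hcut : ∑ v ∈ S, netOut src tgt f v ≤ 0 := by
      rw [sum_netOut]
      refine Finset.sum_nonpos fun a _ => ?_
      have h1 := hup a
      have h2 := hdown a
      by_cases hs : src a ∈ S <;> by_cases ht : tgt a ∈ S <;> simp only [hs, ht] at h1 h2 ⊢ <;>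
        simp at h1 h2 ⊢ <;> omega
    obtain ⟨w, hwS, hw⟩ : ∃ w ∈ S, netOut src tgt f w < 0 := by
      by_contra! h
      exact absurd (Finset.sum_pos' h ⟨x, hxS, hx⟩) (not_lt.2 hcut)
    obtain ⟨Δ, hΔ, hΔa⟩ := hS w hwS
    have hxw : x ≠ w := by rintro rfl; omega
    have hg : P (f - (k : ℤ) • Δ) := by
      intro a
      refine ⟨by simp [(hf a).1], ?_⟩
      have h1 := (hf a).2
      rw [abs_lt] at h1 ⊢
      simp only [Pi.sub_apply, Pi.smul_apply, smul_eq_mul]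
      rcases hΔa a with h | ⟨-, -, ⟨h, h'⟩ | ⟨h, h'⟩⟩
      · simp [h, h1]
      · rw [h']; constructor <;> omega
      · rw [h']; constructor <;> omega
    have hout : ∀ v, netOut src tgt (f - (k : ℤ) • Δ) v = netOut src tgt f v -
        k * ((if v = x then 1 else 0) - (if v = w then 1 else 0)) := by
      intro v
      rw [map_sub, map_zsmul, hΔ]
      simp [Pi.single_apply]
    refine absurd (hmin _ hg) (not_le.2 (Finset.sum_lt_sum (fun v _ => ?_) ⟨x, mem_univ _, ?_⟩))
    · rw [hout]
      by_cases h1 : v = x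
      · subst h1
        have := Int.le_of_dvd hx (hdvd v)
        simp only [if_true, if_neg hxw]
        omega
      · by_cases h2 : v = w
        · subst h2
          have := Int.le_of_dvd (neg_pos.2 hw) ((dvd_neg).2 (hdvd v))
          simp only [if_true, if_neg h1]
          omega
        · simp [h1, h2]
    · rw [hout]
      have := Int.le_of_dvd hx (hdvd x)
      simp only [if_true, if_neg hxw]
      omega
  have htot : ∑ v, netOut src tgt f v = 0 := by
    rw [sum_netOut]
    simp
  ext v
  exact (Finset.sum_eq_zero_iff_of_nonpos fun v _ => hnonpos v).1 htot v (mem_univ v)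

end Flow

section SixFlow

/-- The arcs with exactly one end in `U`. -/
def cutArcs (src tgt : A → V) (U : Finset V) : Finset A :=
  univ.filter fun a => ¬(src a ∈ U ↔ tgt a ∈ U)

/-- The arcs with one end in `X` and the other in `Y`. -/
def betweenArcs (src tgt : A → V) (X Y : Finset V) : Finset A :=
  univ.filter fun a => (src a ∈ X ∧ tgt a ∈ Y) ∨ (src a ∈ Y ∧ tgt a ∈ X)

lemma mem_betweenArcs (src tgt : A → V) (X Y : Finset V) (a : A) :
    a ∈ betweenArcs src tgt X Y ↔ (src a ∈ X ∧ tgt a ∈ Y) ∨ (src a ∈ Y ∧ tgt a ∈ X) := by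
  simp [betweenArcs]

/-- Any arc carries a unit flow between its ends, in either direction. -/
lemma exists_unit_of_mem_betweenArcs (src tgt : A → V) {X Y : Finset V} {a : A}
    (ha : a ∈ betweenArcs src tgt X Y) : ∃ u ∈ X, ∃ v ∈ Y, ∃ ε : ℤ, (ε = 1 ∨ ε = -1) ∧
      ((src a = u ∧ tgt a = v) ∨ (src a = v ∧ tgt a = u)) ∧
      netOut src tgt (Pi.single a ε) = Pi.single u 1 - Pi.single v 1 := by
  rcases (mem_betweenArcs src tgt X Y a).1 ha with ⟨h1, h2⟩ | ⟨h1, h2⟩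
  · exact ⟨_, h1, _, h2, 1, Or.inl rfl, Or.inl ⟨rfl, rfl⟩, netOut_single src tgt a 1⟩
  · refine ⟨_, h2, _, h1, -1, Or.inr rfl, Or.inr ⟨rfl, rfl⟩, ?_⟩
    rw [netOut_single, Pi.single_neg, Pi.single_neg]
    abel

/-- Augmentation of a unit-capacity flow inside a `2`-edge-connected vertex set. -/
lemma exists_augmented_flow (src tgt : A → V) (B : Finset V)
    (hB : ∀ Z ⊆ B, Z.Nonempty → Z ≠ B → 2 ≤ #(betweenArcs src tgt Z (B \ Z)))
    {x y : V} (hx : x ∈ B) (hy : y ∈ B) (c : ℤ) (hc : c < 2) (h : A → ℤ)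
    (hh : netOut src tgt h = c • (Pi.single x 1 - Pi.single y 1))
    (hb : ∀ a, |h a| ≤ 1 ∧ (h a ≠ 0 → src a ∈ B ∧ tgt a ∈ B)) :
    ∃ h' : A → ℤ, netOut src tgt h' = (c + 1) • (Pi.single x 1 - Pi.single y 1) ∧
      ∀ a, |h' a| ≤ 1 ∧ (h' a ≠ 0 → src a ∈ B ∧ tgt a ∈ B) := by
  obtain ⟨S, hxS, hup, hdown, hS⟩ := exists_reachable_set src tgt
    (fun a => h a < 1 ∧ src a ∈ B ∧ tgt a ∈ B) (fun a => -1 < h a ∧ src a ∈ B ∧ tgt a ∈ B) x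
  have hyS : y ∈ S := by
    by_contra hyS
    have h2 := hB (S ∩ B) inter_subset_right ⟨x, by simp [hxS, hx]⟩
      (fun he => hyS (Finset.mem_inter.1 (he ▸ hy)).1)
    have h3 : ∑ v ∈ S ∩ B, netOut src tgt h v = c := by
      rw [hh]
      simp [Pi.single_apply, Finset.sum_sub_distrib, hxS, hx, hyS, ← Finset.mul_sum]
    rw [sum_netOut] at h3
    have h4 : (#(betweenArcs src tgt (S ∩ B) (B \ (S ∩ B))) : ℤ) ≤ c := by
      rw [← h3, betweenArcs, Finset.card_filter, Nat.cast_sum]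
      refine Finset.sum_le_sum fun a _ => ?_
      have k1 := hup a
      have k2 := hdown a
      obtain ⟨k3, k4⟩ := hb a
      rw [abs_le] at k3
      have k5 : (src a ∉ B ∨ tgt a ∉ B) → h a = 0 := by
        intro h
        by_contra h'
        have := k4 h'
        tauto
      clear k4
      simp only [mem_inter, mem_sdiff]
      by_cases a1 : src a ∈ S <;> by_cases a2 : src a ∈ B <;> by_cases a3 : tgt a ∈ S <;>
        by_cases a4 : tgt a ∈ B <;> simp only [a1, a2, a3, a4] at k1 k2 k5 ⊢ <;>
        simp at k1 k2 k5 ⊢ <;> omega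
    omega
  obtain ⟨Δ, hΔ, hΔa⟩ := hS y hyS
  refine ⟨h + Δ, ?_, fun a => ?_⟩
  · rw [map_add, hh, hΔ, add_smul, one_smul]
  · obtain ⟨k1, k2⟩ := hb a
    rw [abs_le] at k1
    simp only [Pi.add_apply]
    rcases hΔa a with h0 | ⟨-, -, ⟨⟨h1, h2⟩, h3⟩ | ⟨⟨h1, h2⟩, h3⟩⟩
    · rw [h0, add_zero, abs_le]
      exact ⟨k1, k2⟩
    · rw [h3, abs_le]
      exact ⟨by omega, fun _ => h2⟩
    · rw [h3, abs_le]
      exact ⟨by omega, fun _ => h2⟩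

/-- Two vertices of a `2`-edge-connected vertex set lie on a common connected subgraph that is the
support of a unit-capacity flow of value two between them. -/
lemma exists_connected_two_flow (src tgt : A → V) (B : Finset V)
    (hB : ∀ Z ⊆ B, Z.Nonempty → Z ≠ B → 2 ≤ #(betweenArcs src tgt Z (B \ Z)))
    {x y : V} (hx : x ∈ B) (hy : y ∈ B) :
    ∃ K ⊆ B, x ∈ K ∧ y ∈ K ∧ ∃ h : A → ℤ,
      netOut src tgt h = (2 : ℤ) • (Pi.single x 1 - Pi.single y 1) ∧
      (∀ a, |h a| ≤ 1) ∧ (∀ a, h a ≠ 0 → src a ∈ K ∧ tgt a ∈ K) ∧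
      ∀ w ∈ K, ∃ Δ : A → ℤ, netOut src tgt Δ = Pi.single x 1 - Pi.single w 1 ∧
        ∀ a, Δ a ≠ 0 → h a ≠ 0 := by
  obtain ⟨h₁, hh₁, hb₁⟩ := exists_augmented_flow src tgt B hB hx hy 0 (by norm_num) 0
    (by simp) (by simp)
  obtain ⟨h, hh, hb⟩ := exists_augmented_flow src tgt B hB hx hy 1 (by norm_num) h₁
    (by simpa using hh₁) hb₁
  norm_num at hh
  obtain ⟨S, hxS, hup, hdown, hS⟩ := exists_reachable_set src tgt
    (fun a => h a ≠ 0) (fun a => h a ≠ 0) x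
  have hiff : ∀ a, h a ≠ 0 → (src a ∈ S ↔ tgt a ∈ S) := fun a ha => ⟨hup a ha, hdown a ha⟩
  let h' : A → ℤ := fun a => if src a ∈ S then h a else 0
  have hh' : ∀ v, netOut src tgt h' v = if v ∈ S then netOut src tgt h v else 0 := by
    intro v
    by_cases hv : v ∈ S
    · rw [if_pos hv, netOut_apply, netOut_apply]
      refine Finset.sum_congr rfl fun a _ => ?_
      by_cases h0 : h a = 0
      · simp [h', h0]
      · have := hiff a h0
        by_cases h1 : src a = v
        · simp [h', h1, hv]
        · by_cases h2 : tgt a = v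
          · simp [h', h2, hv, this]
          · simp [h1, h2]
    · rw [if_neg hv, netOut_apply]
      refine Finset.sum_eq_zero fun a _ => ?_
      by_cases h0 : h a = 0
      · simp [h', h0]
      · have := hiff a h0
        by_cases h1 : src a = v
        · have h3 : src a ∉ S := h1 ▸ hv
          simp [h', h3]
        · by_cases h2 : tgt a = v
          · have h3 : tgt a ∉ S := h2 ▸ hv
            rw [← this] at h3
            simp [h', h3]
          · simp [h1, h2]
  have hyS : y ∈ S := by
    by_contra hyS
    have h3 : ∑ v ∈ S, netOut src tgt h v = 2 := by
      rw [hh]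
      simp [Pi.single_apply, Finset.sum_sub_distrib, hxS, hyS, ← Finset.mul_sum]
    rw [sum_netOut, Finset.sum_eq_zero] at h3
    · norm_num at h3
    · intro a _
      by_cases h0 : h a = 0
      · simp [h0]
      · simp [hiff a h0]
  refine ⟨S ∩ B, inter_subset_right, by simp [hxS, hx], by simp [hyS, hy], h', ?_, ?_, ?_, ?_⟩
  · ext v
    rw [hh', hh]
    by_cases hv : v ∈ S
    · simp [hv]
    · have h1 : v ≠ x := fun he => hv (he ▸ hxS)
      have h2 : v ≠ y := fun he => hv (he ▸ hyS)
      simp [hv, h1, h2]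
  · intro a
    by_cases hs : src a ∈ S
    · simpa [h', hs] using (hb a).1
    · simp [h', hs]
  · intro a ha
    by_cases hs : src a ∈ S
    · have h0 : h a ≠ 0 := by simpa [h', hs] using ha
      have h1 := (hb a).2 h0
      simp [hs, (hiff a h0).1 hs, h1]
    · simp [h', hs] at ha
  · intro w hw
    obtain ⟨Δ, hΔ, hΔa⟩ := hS w (Finset.mem_inter.1 hw).1
    refine ⟨Δ, hΔ, fun a ha => ?_⟩
    rcases hΔa a with h0 | ⟨h1, -, h2⟩
    · exact absurd h0 ha
    · have : h a ≠ 0 := by tauto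
      simpa [h', h1] using this

/-- In a graph without cuts of size at most two, outside every proper vertex set `S` there is a
`2`-edge-connected vertex set joined to `S` by at least two arcs. -/
lemma exists_two_connected_outside (src tgt : A → V)
    (h3 : ∀ U : Finset V, U.Nonempty → U ≠ univ → 3 ≤ #(cutArcs src tgt U))
    (S : Finset V) (hSne : S.Nonempty) (hS : S ≠ univ) :
    ∃ B : Finset V, B.Nonempty ∧ Disjoint S B ∧ 2 ≤ #(betweenArcs src tgt S B) ∧
      ∀ Z ⊆ B, Z.Nonempty → Z ≠ B → 2 ≤ #(betweenArcs src tgt Z (B \ Z)) := by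
  let I : Finset V → Prop := fun B => B.Nonempty ∧ B ⊆ Sᶜ ∧ #(betweenArcs src tgt B (Sᶜ \ B)) ≤ 1
  have h0 : I Sᶜ := by
    refine ⟨by rw [Finset.nonempty_iff_ne_empty]; simpa using hS, Subset.rfl, ?_⟩
    simp [betweenArcs]
  obtain ⟨B, ⟨hBne, hBS, hB1⟩, hmin⟩ := (Set.toFinite {B | I B}).exists_minimal ⟨_, h0⟩
  have hBd : ∀ v ∈ B, v ∉ S := fun v hv => Finset.mem_compl.1 (hBS hv)
  refine ⟨B, hBne, Finset.disjoint_right.2 hBd, ?_, fun Z hZB hZne hZ => ?_⟩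
  · have hcut := h3 B hBne (by
      rintro rfl
      obtain ⟨v, hv⟩ := hSne
      exact hBd v (mem_univ v) hv)
    have : cutArcs src tgt B ⊆ betweenArcs src tgt S B ∪ betweenArcs src tgt B (Sᶜ \ B) := by
      intro a ha
      simp only [cutArcs, mem_filter, mem_univ, true_and] at ha
      simp only [mem_union, mem_betweenArcs, mem_sdiff, mem_compl]
      tauto
    have := (card_le_card this).trans (card_union_le _ _)
    omega
  · by_contra hlt
    have hpart : ∀ W ⊆ B, W.Nonempty → W ≠ B → #(betweenArcs src tgt W (B \ W)) ≤ 1 →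
        1 ≤ #(betweenArcs src tgt W (Sᶜ \ B)) := by
      intro W hWB hWne hW hle
      have h2 : 2 ≤ #(betweenArcs src tgt W (Sᶜ \ W)) := by
        by_contra hlt
        exact hW (Subset.antisymm hWB (hmin ⟨hWne, hWB.trans hBS, by omega⟩ hWB))
      have : betweenArcs src tgt W (Sᶜ \ W) ⊆
          betweenArcs src tgt W (B \ W) ∪ betweenArcs src tgt W (Sᶜ \ B) := by
        intro a ha
        simp only [mem_union, mem_betweenArcs, mem_sdiff, mem_compl] at ha ⊢
        tauto
      have := (card_le_card this).trans (card_union_le _ _)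
      omega
    have hZ1 := hpart Z hZB hZne hZ (by omega)
    have hsd : B \ (B \ Z) = Z := Finset.sdiff_sdiff_eq_self hZB
    have hZ2 := hpart (B \ Z) sdiff_subset
      (Finset.sdiff_nonempty.2 fun h => hZ (Subset.antisymm hZB h))
      (fun h => by
        rw [h, Finset.sdiff_self] at hsd
        exact hZne.ne_empty hsd.symm)
      (by
        rw [hsd]
        have : betweenArcs src tgt (B \ Z) Z = betweenArcs src tgt Z (B \ Z) := by
          ext a
          simp only [mem_betweenArcs]
          tauto
        rw [this]
        omega)
    have hdis : Disjoint (betweenArcs src tgt Z (Sᶜ \ B))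
        (betweenArcs src tgt (B \ Z) (Sᶜ \ B)) := by
      rw [Finset.disjoint_left]
      intro a h1 h2
      have s1 := @hZB (src a)
      have s2 := @hZB (tgt a)
      simp only [mem_betweenArcs, mem_sdiff, mem_compl] at h1 h2
      tauto
    have hsub : betweenArcs src tgt Z (Sᶜ \ B) ∪ betweenArcs src tgt (B \ Z) (Sᶜ \ B) ⊆
        betweenArcs src tgt B (Sᶜ \ B) := by
      intro a ha
      have s1 := @hZB (src a)
      have s2 := @hZB (tgt a)
      simp only [mem_union, mem_betweenArcs, mem_sdiff, mem_compl] at ha ⊢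
      tauto
    have := card_le_card hsub
    rw [card_union_of_disjoint hdis] at this
    omega

/-- A connected subgraph with vertex set `S` and arc set `Y`, together with a `ℤ/2`-flow `x` on it,
such that `ℤ/3`-flows on `Y` can avoid any prescribed values wherever `x` vanishes. -/
structure AvoidingSubgraph (src tgt : A → V) (r : V) (S : Finset V) (Y : Finset A)
    (x : A → ZMod 2) : Prop where
  root_mem : r ∈ S
  flow : netOut src tgt x = 0
  support : ∀ a, x a ≠ 0 → a ∈ Y
  ends_mem : ∀ a ∈ Y, src a ∈ S ∧ tgt a ∈ S
  connected : ∀ s ∈ S, ∃ Δ : A → ℤ, netOut src tgt Δ = Pi.single s 1 - Pi.single r 1 ∧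
    ∀ a, Δ a ≠ 0 → a ∈ Y
  avoid : ∀ g : A → ZMod 3, ∃ f : A → ZMod 3, netOut src tgt f = 0 ∧ (∀ a, f a ≠ 0 → a ∈ Y) ∧
    ∀ a ∈ Y, x a = 0 → f a + g a ≠ 0

lemma netOut_intCast (src tgt : A → V) (n : ℕ) (f : A → ℤ) (v : V) :
    netOut src tgt (fun a => (f a : ZMod n)) v = ((netOut src tgt f v : ℤ) : ZMod n) :=
  netOut_comp src tgt (Int.castAddHom (ZMod n)) f v

lemma AvoidingSubgraph.exists_larger (src tgt : A → V)
    (h3 : ∀ U : Finset V, U.Nonempty → U ≠ univ → 3 ≤ #(cutArcs src tgt U))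
    {r : V} {S : Finset V} {Y : Finset A} {x : A → ZMod 2}
    (H : AvoidingSubgraph src tgt r S Y x) (hS : S ≠ univ) :
    ∃ S' Y' x', S ⊂ S' ∧ AvoidingSubgraph src tgt r S' Y' x' := by
  obtain ⟨B, hBne, hSB, hcard, hB⟩ := exists_two_connected_outside src tgt h3 S ⟨r, H.root_mem⟩ hS
  obtain ⟨e₁, he₁, e₂, he₂, hne⟩ := Finset.one_lt_card.1 hcard
  obtain ⟨s₁, hs₁, p, hp, ε₁, hε₁, hend₁, hnet₁⟩ := exists_unit_of_mem_betweenArcs src tgt he₁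
  obtain ⟨s₂, hs₂, q, hq, ε₂, hε₂, hend₂, hnet₂⟩ := exists_unit_of_mem_betweenArcs src tgt he₂
  obtain ⟨K, hKB, hpK, hqK, h, hh, hh1, hhK, hconn⟩ := exists_connected_two_flow src tgt B hB hp hq
  have hSK : ∀ v ∈ K, v ∉ S := fun v hv hv' => Finset.disjoint_left.1 hSB hv' (hKB hv)
  obtain ⟨Δ₁, hΔ₁, hΔ₁Y⟩ := H.connected s₁ hs₁
  obtain ⟨Δ₂, hΔ₂, hΔ₂Y⟩ := H.connected s₂ hs₂
  have hYh : ∀ a ∈ Y, h a = 0 := fun a ha => by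
    by_contra h0
    exact hSK _ (hhK a h0).1 (H.ends_mem a ha).1
  have hmix : ∀ a s k, s ∈ S → k ∈ K → (src a = s ∧ tgt a = k ∨ src a = k ∧ tgt a = s) →
      a ∉ Y ∧ h a = 0 := by
    intro a s k hs hk ha
    constructor
    · intro haY
      have := H.ends_mem a haY
      rcases ha with ⟨-, h⟩ | ⟨h, -⟩
      · exact hSK k hk (h ▸ this.2)
      · exact hSK k hk (h ▸ this.1)
    · by_contra h0
      have := hhK a h0
      rcases ha with ⟨h, -⟩ | ⟨-, h⟩
      · exact hSK s (h ▸ this.1) hs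
      · exact hSK s (h ▸ this.2) hs
  obtain ⟨he₁Y, he₁h⟩ := hmix e₁ s₁ p hs₁ hpK hend₁
  obtain ⟨he₂Y, he₂h⟩ := hmix e₂ s₂ q hs₂ hqK hend₂
  have hΔ₁0 : ∀ a, a ∉ Y → Δ₁ a = 0 := fun a ha => by_contra fun h0 => ha (hΔ₁Y a h0)
  have hΔ₂0 : ∀ a, a ∉ Y → Δ₂ a = 0 := fun a ha => by_contra fun h0 => ha (hΔ₂Y a h0)
  let D : A → ℤ := Pi.single e₁ ε₁ - h - Pi.single e₂ ε₂ + (Δ₂ - Δ₁)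
  let C : A → ZMod 3 := fun a => (D a : ZMod 3)
  have hC : netOut src tgt C = 0 := by
    ext v
    have : netOut src tgt D = (3 : ℤ) • (Pi.single q 1 - Pi.single p 1) := by
      simp only [D, map_add, map_sub, hh, hnet₁, hnet₂, hΔ₁, hΔ₂]
      module
    rw [netOut_intCast, this]
    simp only [Pi.smul_apply, smul_eq_mul, Int.cast_mul, Pi.zero_apply]
    rw [show ((3 : ℤ) : ZMod 3) = 0 from rfl, zero_mul]
  have hCe₁ : C e₁ = 1 ∨ C e₁ = -1 := by
    have : D e₁ = ε₁ := by
      simp [D, he₁h, hΔ₁0 e₁ he₁Y, hΔ₂0 e₁ he₁Y, hne]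
    rcases hε₁ with h | h <;> simp [C, this, h]
  have hCe₂ : C e₂ = 1 ∨ C e₂ = -1 := by
    have : D e₂ = -ε₂ := by
      simp [D, he₂h, hΔ₁0 e₂ he₂Y, hΔ₂0 e₂ he₂Y, hne.symm]
    rcases hε₂ with h | h <;> simp [C, this, h]
  let Y' : Finset A := Y ∪ univ.filter (fun a => h a ≠ 0) ∪ {e₁, e₂}
  have hY' : ∀ a, a ∈ Y' ↔ (a ∈ Y ∨ h a ≠ 0) ∨ a = e₁ ∨ a = e₂ := by
    intro a
    simp only [Y', mem_union, mem_filter, mem_univ, true_and, mem_insert, mem_singleton]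
  have hCY' : ∀ a, C a ≠ 0 → a ∈ Y' := by
    intro a ha
    by_contra hn
    rw [hY'] at hn
    push Not at hn
    obtain ⟨⟨n1, n2⟩, n3, n4⟩ := hn
    exact ha (by simp [C, D, n2, n3, n4, hΔ₁0 a n1, hΔ₂0 a n1])
  have hx0 : ∀ a, a ∉ Y → x a = 0 := fun a ha => by_contra fun h0 => ha (H.support a h0)
  refine ⟨S ∪ K, Y', fun a => x a + (h a : ZMod 2), ?_, ?_, ?_, ?_, ?_, ?_, ?_⟩
  · exact ⟨subset_union_left, fun hs => hSK p hpK (hs (Finset.mem_union_right _ hpK))⟩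
  · exact Finset.mem_union_left _ H.root_mem
  · have := (netOut src tgt).map_add x (fun a => (h a : ZMod 2))
    rw [H.flow, zero_add] at this
    refine this.trans ?_
    ext v
    rw [netOut_intCast, hh]
    simp only [Pi.smul_apply, smul_eq_mul, Int.cast_mul, Pi.zero_apply]
    rw [show ((2 : ℤ) : ZMod 2) = 0 from rfl, zero_mul]
  · intro a ha
    rw [hY']
    by_contra hn
    push Not at hn
    obtain ⟨⟨n1, n2⟩, -⟩ := hn
    exact ha (by simp [hx0 a n1, n2])
  · intro a ha
    rw [hY'] at ha
    simp only [mem_union]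
    rcases ha with (ha | ha) | rfl | rfl
    · exact ⟨Or.inl (H.ends_mem a ha).1, Or.inl (H.ends_mem a ha).2⟩
    · exact ⟨Or.inr (hhK a ha).1, Or.inr (hhK a ha).2⟩
    · rcases hend₁ with ⟨h1, h2⟩ | ⟨h1, h2⟩ <;> simp [h1, h2, hs₁, hpK]
    · rcases hend₂ with ⟨h1, h2⟩ | ⟨h1, h2⟩ <;> simp [h1, h2, hs₂, hqK]
  · intro w hw
    rcases Finset.mem_union.1 hw with hw | hw
    · obtain ⟨Δ, hΔ, hΔY⟩ := H.connected w hw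
      exact ⟨Δ, hΔ, fun a ha => (hY' a).2 (Or.inl (Or.inl (hΔY a ha)))⟩
    · obtain ⟨Δ, hΔ, hΔh⟩ := hconn w hw
      refine ⟨Δ₁ - Pi.single e₁ ε₁ - Δ, ?_, fun a ha => ?_⟩
      · simp only [map_sub, hΔ₁, hnet₁, hΔ]
        abel
      · by_contra hn
        rw [hY'] at hn
        push Not at hn
        obtain ⟨⟨n1, n2⟩, n3, -⟩ := hn
        have : Δ a = 0 := by_contra fun h0 => hΔh a h0 n2
        exact ha (by simp [this, n3, hΔ₁0 a n1])
  · intro g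
    obtain ⟨c, hc₁, hc₂⟩ : ∃ c : ZMod 3, c * C e₁ + g e₁ ≠ 0 ∧ c * C e₂ + g e₂ ≠ 0 := by
      have key : ∀ u v s t : ZMod 3, (u = 1 ∨ u = -1) → (v = 1 ∨ v = -1) →
          ∃ c : ZMod 3, c * u + s ≠ 0 ∧ c * v + t ≠ 0 := by decide
      exact key _ _ _ _ hCe₁ hCe₂
    obtain ⟨f, hf, hfY, hfa⟩ := H.avoid (fun a => c * C a + g a)
    have hcC : netOut src tgt (fun a => c * C a) = 0 := by
      ext v
      have := netOut_comp src tgt (AddMonoidHom.mulLeft c) C v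
      simp only [AddMonoidHom.coe_mulLeft] at this
      rw [this, hC]
      simp
    refine ⟨f + fun a => c * C a, by rw [map_add, hf, hcC, add_zero], fun a ha => ?_,
      fun a ha hxa => ?_⟩
    · by_contra hn
      have h1 : C a = 0 := by_contra fun h0 => hn (hCY' a h0)
      have h2 : f a = 0 := by_contra fun h0 => hn ((hY' a).2 (Or.inl (Or.inl (hfY a h0))))
      exact ha (by simp [h1, h2])
    · rw [Pi.add_apply, add_assoc]
      by_cases haY : a ∈ Y
      · exact hfa a haY (by simpa [hYh a haY] using hxa)
      · have hfa0 : f a = 0 := by_contra fun h0 => haY (hfY a h0)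
        rw [hfa0, zero_add]
        rcases (hY' a).1 ha with (ha | ha) | rfl | rfl
        · exact absurd ha haY
        · exfalso
          have h1 := hh1 a
          rw [abs_le] at h1
          rw [hx0 a haY, zero_add] at hxa
          obtain h2 | h2 : h a = 1 ∨ h a = -1 := by omega
          · simp [h2] at hxa
          · simp [h2] at hxa
        · exact hc₁
        · exact hc₂

/-- Seymour's six-flow theorem for graphs without cuts of size at most two. -/
lemma exists_nowhere_zero_flow_of_three_le_cut [Nonempty V] (src tgt : A → V)
    (h3 : ∀ U : Finset V, U.Nonempty → U ≠ univ → 3 ≤ #(cutArcs src tgt U)) :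
    ∃ φ : A → ZMod 2 × ZMod 3, netOut src tgt φ = 0 ∧ ∀ a, φ a ≠ 0 := by
  obtain ⟨r⟩ := ‹Nonempty V›
  have h0 : ∃ Y x, AvoidingSubgraph src tgt r {r} Y x := by
    refine ⟨∅, 0, by simp, by simp, by simp, by simp, fun s hs => ⟨0, ?_, by simp⟩,
      fun g => ⟨0, by simp⟩⟩
    rw [Finset.mem_singleton.1 hs]
    simp
  obtain ⟨S, ⟨Y, x, H⟩, hmax⟩ := (Set.toFinite
    {S | ∃ Y x, AvoidingSubgraph src tgt r S Y x}).exists_maximal ⟨_, h0⟩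
  have hS : S = univ := by
    by_contra hS
    obtain ⟨S', Y', x', hlt, H'⟩ := H.exists_larger src tgt h3 hS
    exact hlt.2 (hmax ⟨Y', x', H'⟩ hlt.1)
  subst hS
  choose Δ hΔ hΔY using fun v => H.connected v (mem_univ v)
  let D : A → ℤ := ∑ a ∈ univ \ Y, (Pi.single a 1 + (Δ (tgt a) - Δ (src a)))
  have hD : netOut src tgt D = 0 := by
    rw [map_sum]
    refine Finset.sum_eq_zero fun a _ => ?_
    rw [map_add, map_sub, netOut_single, hΔ, hΔ]
    abel
  have hDa : ∀ a, a ∉ Y → D a = 1 := by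
    intro a ha
    have hz : ∀ v, Δ v a = 0 := fun v => by_contra fun h0 => ha (hΔY v a h0)
    simp only [D, Finset.sum_apply, Pi.add_apply, Pi.sub_apply, hz, sub_zero, add_zero]
    rw [Finset.sum_pi_single]
    simp [ha]
  obtain ⟨f, hf, hfY, hfa⟩ := H.avoid fun a => (D a : ZMod 3)
  have hg : netOut src tgt (f + fun a => (D a : ZMod 3)) = 0 := by
    rw [map_add, hf, zero_add]
    ext v
    rw [netOut_intCast, hD]
    simp
  refine ⟨fun a => (x a, f a + (D a : ZMod 3)), ?_, fun a ha => ?_⟩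
  · ext v
    · have := netOut_comp src tgt (AddMonoidHom.fst (ZMod 2) (ZMod 3))
        (fun a => (x a, f a + (D a : ZMod 3))) v
      simp only [AddMonoidHom.coe_fst] at this
      rw [← this]
      exact congrFun H.flow v
    · have := netOut_comp src tgt (AddMonoidHom.snd (ZMod 2) (ZMod 3))
        (fun a => (x a, f a + (D a : ZMod 3))) v
      simp only [AddMonoidHom.coe_snd] at this
      rw [← this]
      exact congrFun hg v
  · rw [Prod.mk_eq_zero] at ha
    by_cases haY : a ∈ Y
    · exact hfa a haY ha.1 ha.2
    · have hfa0 : f a = 0 := by_contra fun h0 => haY (hfY a h0)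
      have := ha.2
      rw [hfa0, hDa a haY] at this
      simp at this

/-- Identifying the ends of an arc of a two-arc cut: a nowhere-zero flow of the contracted graph
yields one of the original graph. -/
lemma exists_nowhere_zero_flow_of_contract {M : Type*} [AddCommGroup M] {W : Type*} [Fintype W]
    [DecidableEq W] (src tgt : A → V) (U : Finset V) (hU : #(cutArcs src tgt U) = 2) {e : A}
    (he : e ∈ cutArcs src tgt U) (π : V → W)
    (hπ : ∀ u v, π u = π v ↔ u = v ∨ (u = src e ∧ v = tgt e) ∨ (u = tgt e ∧ v = src e))
    (φ : A → M) (hφ : netOut (π ∘ src) (π ∘ tgt) φ = 0) (hnz : ∀ a, φ a ≠ 0) :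
    ∃ ψ : A → M, netOut src tgt ψ = 0 ∧ ∀ a, ψ a ≠ 0 := by
  have hst : src e ≠ tgt e := by
    intro h
    simp [cutArcs, h] at he
  have hfib : ∀ v, ∑ u with π u = π v, netOut src tgt φ u = 0 := by
    intro v
    rw [sum_netOut]
    simpa [netOut_apply] using congrFun hφ (π v)
  let m := netOut src tgt φ (src e)
  let ψ : A → M := φ - Pi.single e m
  have hψ : netOut src tgt ψ = 0 := by
    ext v
    rw [map_sub, netOut_single]
    have hv := hfib v
    have h1 := hfib (src e)
    have hset : (univ.filter fun u => π u = π (src e)) = {src e, tgt e} := by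
      ext u
      simp only [mem_filter, mem_univ, true_and, mem_insert, mem_singleton, hπ]
      tauto
    rw [hset, Finset.sum_pair hst] at h1
    by_cases hvs : v = src e
    · subst hvs
      simp [m, hst]
    · by_cases hvt : v = tgt e
      · subst hvt
        simp only [Pi.sub_apply, Pi.single_eq_same, Pi.single_eq_of_ne hst.symm, Pi.zero_apply, m,
          zero_sub, sub_neg_eq_add]
        rw [add_comm]
        exact h1
      · have : (univ.filter fun u => π u = π v) = {v} := by
          ext u
          simp only [mem_filter, mem_univ, true_and, mem_singleton, hπ]
          tauto
        rw [this, Finset.sum_singleton] at hv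
        simp [hv, hvs, hvt]
  refine ⟨ψ, hψ, fun a ha => ?_⟩
  by_cases hae : a = e
  · subst hae
    obtain ⟨b, hb⟩ := Finset.card_eq_one.1
      (show #((cutArcs src tgt U).erase a) = 1 by rw [Finset.card_erase_of_mem he, hU])
    have hbm : b ∈ (cutArcs src tgt U).erase a := by rw [hb]; simp
    have hsum := sum_netOut src tgt ψ U
    rw [hψ, Finset.sum_eq_single b] at hsum
    · have hbψ : ψ b = φ b := by simp [ψ, (Finset.mem_erase.1 hbm).1]
      have hbc := (Finset.mem_erase.1 hbm).2
      rw [hbψ] at hsum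
      simp only [cutArcs, mem_filter, mem_univ, true_and] at hbc
      refine hnz b ?_
      by_cases h1 : src b ∈ U <;> by_cases h2 : tgt b ∈ U <;> simp [h1, h2] at hsum hbc <;>
        first | exact hsum | exact hsum.symm
    · intro d _ hdb
      by_cases hda : d = a
      · simp [hda, ha]
      · have : d ∉ cutArcs src tgt U := fun hd => by
          have : d ∈ (cutArcs src tgt U).erase a := Finset.mem_erase.2 ⟨hda, hd⟩
          rw [hb] at this
          exact hdb (Finset.mem_singleton.1 this)
        simp only [cutArcs, mem_filter, mem_univ, true_and, not_not] at this
        simp [this]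
    · simp
  · exact hnz a (by simpa [ψ, hae] using ha)

/-- Seymour's six-flow theorem, in group-valued form. -/
lemma exists_nowhere_zero_group_flow (n : ℕ) : ∀ {W : Type*} [Fintype W] [DecidableEq W]
    [Nonempty W] (src tgt : A → W), Fintype.card W = n →
    (∀ U : Finset W, U.Nonempty → U ≠ univ → 2 ≤ #(cutArcs src tgt U)) →
    ∃ φ : A → ZMod 2 × ZMod 3, netOut src tgt φ = 0 ∧ ∀ a, φ a ≠ 0 := by
  induction n with
  | zero =>
    intro W _ _ _ src tgt hn
    exact absurd hn Fintype.card_ne_zero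
  | succ n ih =>
    intro W _ _ _ src tgt hn h2
    by_cases h3 : ∀ U : Finset W, U.Nonempty → U ≠ univ → 3 ≤ #(cutArcs src tgt U)
    · exact exists_nowhere_zero_flow_of_three_le_cut src tgt h3
    push Not at h3
    obtain ⟨U, hUne, hUu, hlt⟩ := h3
    have hU : #(cutArcs src tgt U) = 2 := le_antisymm (by omega) (h2 U hUne hUu)
    obtain ⟨e, he⟩ := Finset.card_pos.1 (by omega : 0 < #(cutArcs src tgt U))
    have hst : src e ≠ tgt e := by
      intro h
      simp [cutArcs, h] at he
    let π : W → {w : W // w ≠ tgt e} := fun w => if h : w = tgt e then ⟨src e, hst⟩ else ⟨w, h⟩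
    have hπ : ∀ u v, π u = π v ↔ u = v ∨ (u = src e ∧ v = tgt e) ∨ (u = tgt e ∧ v = src e) := by
      intro u v
      by_cases hu : u = tgt e <;> by_cases hv : v = tgt e
      · simp [hu, hv]
      · simp only [π, hu, hv, dite_true, dite_false, Subtype.mk.injEq]
        grind
      · simp only [π, hu, hv, dite_true, dite_false, Subtype.mk.injEq]
        grind
      · simp only [π, hu, hv, dite_false, Subtype.mk.injEq]
        grind
    have hsurj : ∀ w : {w : W // w ≠ tgt e}, π w = w := fun w => by simp [π, w.2]
    have : Nonempty {w : W // w ≠ tgt e} := ⟨⟨src e, hst⟩⟩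
    obtain ⟨φ, hφ, hnz⟩ := ih (π ∘ src) (π ∘ tgt) (by
      rw [Fintype.card_subtype_compl, hn]
      simp) (by
      intro X hX hXu
      have hcut : cutArcs (π ∘ src) (π ∘ tgt) X =
          cutArcs src tgt (univ.filter fun w => π w ∈ X) := by
        ext a
        simp [cutArcs]
      rw [hcut]
      refine h2 _ ?_ fun h => hXu ?_
      · obtain ⟨w, hw⟩ := hX
        exact ⟨w, by simp [hsurj, hw]⟩
      · ext w
        have : (w : W) ∈ univ.filter fun w => π w ∈ X := by rw [h]; exact mem_univ _
        simpa [hsurj] using this)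
    exact exists_nowhere_zero_flow_of_contract src tgt U hU he π hπ φ hφ hnz

/-- Seymour's six-flow theorem: a connected graph without bridges has a nowhere-zero `6`-flow. -/
theorem exists_nowhere_zero_six_flow [Nonempty V] (src tgt : A → V)
    (h2 : ∀ U : Finset V, U.Nonempty → U ≠ univ → 2 ≤ #(cutArcs src tgt U)) :
    ∃ f : A → ℤ, netOut src tgt f = 0 ∧ ∀ a, f a ≠ 0 ∧ |f a| < 6 := by
  obtain ⟨φ, hφ, hnz⟩ := exists_nowhere_zero_group_flow _ src tgt rfl h2
  let e : ZMod 2 × ZMod 3 ≃+* ZMod 6 := (ZMod.chineseRemainder (m := 2) (n := 3) (by norm_num)).symm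
  refine exists_int_flow_of_modular src tgt 6 (by norm_num) (fun a => e (φ a)) ?_ fun a ha =>
    hnz a (by simpa using ha)
  ext v
  have := netOut_comp src tgt (e : ZMod 2 × ZMod 3 →+ ZMod 6) φ v
  rw [hφ] at this
  simpa using this

end SixFlow

section Packing

/-- The values of a nowhere-zero `6`-flow on a dicut balance, so at least a sixth of its arcs carry
a positive value. -/
lemma card_outArcs_le_six_mul_card_pos (src tgt : A → V) (f : A → ℤ) (hf : netOut src tgt f = 0)
    (hb : ∀ a, f a ≠ 0 ∧ |f a| < 6) (U : Finset V) (hU : inArcs src tgt U = ∅) :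
    #(outArcs src tgt U) ≤ 6 * #(outArcs src tgt U ∩ univ.filter fun a => 0 < f a) := by
  have h := sum_netOut_eq_cut src tgt f U
  rw [hU, hf] at h
  simp only [Pi.zero_apply, Finset.sum_const_zero, Finset.sum_empty, sub_zero] at h
  have key : ∑ a ∈ outArcs src tgt U, (1 + f a) ≤
      ∑ a ∈ outArcs src tgt U, if 0 < f a then (6 : ℤ) else 0 := by
    refine Finset.sum_le_sum fun a _ => ?_
    obtain ⟨h0, h1⟩ := hb a
    rw [abs_lt] at h1
    split_ifs <;> omega
  rw [Finset.sum_add_distrib, ← h, ← Finset.sum_filter] at key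
  have hset : outArcs src tgt U ∩ (univ.filter fun a => 0 < f a) =
      (outArcs src tgt U).filter fun a => 0 < f a := by
    ext a
    simp
  rw [hset]
  simp only [Finset.sum_const, nsmul_eq_mul] at key
  omega

lemma inArcs_reverse_compl (src tgt : A → V) (U : Finset V) :
    inArcs tgt src Uᶜ = inArcs src tgt U := by
  ext a
  simp only [inArcs, mem_filter, mem_univ, true_and, mem_compl, not_not]
  tauto

lemma outArcs_reverse_compl (src tgt : A → V) (U : Finset V) :
    outArcs tgt src Uᶜ = outArcs src tgt U := by
  ext a
  simp only [outArcs, mem_filter, mem_univ, true_and, mem_compl, not_not]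
  tauto

lemma inArcs_compl (src tgt : A → V) (U : Finset V) :
    inArcs src tgt Uᶜ = outArcs src tgt U := by
  ext a
  simp only [inArcs, outArcs, mem_filter, mem_univ, true_and, mem_compl, not_not]
  tauto

lemma IsDicut.reverse_compl {src tgt : A → V} {U : Finset V} (hU : IsDicut src tgt U) :
    IsDicut tgt src Uᶜ := by
  obtain ⟨h1, h2, h3⟩ := hU
  refine ⟨?_, ?_, by rwa [inArcs_reverse_compl]⟩
  · rw [Finset.nonempty_iff_ne_empty]
    simpa using h2
  · simpa [Finset.nonempty_iff_ne_empty] using h1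

/-- If all dicuts have size at least two, then so have all cuts. -/
lemma two_le_card_cutArcs (src tgt : A → V)
    (hmin : ∀ U : Finset V, IsDicut src tgt U → 2 ≤ #(outArcs src tgt U))
    (U : Finset V) (hne : U.Nonempty) (hU : U ≠ univ) : 2 ≤ #(cutArcs src tgt U) := by
  have hcard : #(cutArcs src tgt U) = #(outArcs src tgt U) + #(inArcs src tgt U) := by
    rw [← card_union_of_disjoint]
    · congr 1
      ext a
      simp only [cutArcs, outArcs, inArcs, mem_filter, mem_univ, true_and, mem_union]
      tauto
    · rw [Finset.disjoint_left]
      intro a h1 h2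
      simp only [outArcs, inArcs, mem_filter, mem_univ, true_and] at h1 h2
      tauto
  by_cases hin : inArcs src tgt U = ∅
  · have := hmin U ⟨hne, hU, hin⟩
    omega
  by_cases hout : outArcs src tgt U = ∅
  · have hc : inArcs src tgt Uᶜ = ∅ := by rw [inArcs_compl, hout]
    have := hmin Uᶜ ⟨by rw [Finset.nonempty_iff_ne_empty]; simpa using hU,
      by simpa [Finset.nonempty_iff_ne_empty] using hne, hc⟩
    rw [← inArcs_compl, compl_compl] at this
    omega
  have h1 := Finset.card_pos.2 (Finset.nonempty_iff_ne_empty.2 hin)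
  have h2 := Finset.card_pos.2 (Finset.nonempty_iff_ne_empty.2 hout)
  omega

end Packing

/-- Every digraph with minimum dicut size `τ` contains `⌊τ/6⌋` pairwise arc-disjoint dijoins. -/
theorem pack_tau_div_six_dijoins (src tgt : A → V) (τ : ℕ)
    (hmin : ∀ U : Finset V, IsDicut src tgt U → τ ≤ (outArcs src tgt U).card) :
    ∃ J : Fin (τ / 6) → Finset A,
      (∀ i j, i ≠ j → Disjoint (J i) (J j)) ∧ ∀ i, IsDijoin src tgt (J i) := by
  rcases isEmpty_or_nonempty V with hV | hV
  · exact ⟨fun _ => ∅, by simp, fun _ U hU => (hU.1.ne_empty (Subsingleton.elim _ _)).elim⟩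
  rcases lt_or_ge τ 6 with hτ | hτ
  · have h0 : τ / 6 = 0 := Nat.div_eq_of_lt hτ
    rw [h0]
    exact ⟨fun _ => ∅, by simp, fun i => i.elim0⟩
  obtain ⟨f, hf, hb⟩ := exists_nowhere_zero_six_flow src tgt
    (two_le_card_cutArcs src tgt fun U hU => by have := hmin U hU; omega)
  obtain ⟨r⟩ := hV
  obtain ⟨J, hJP, hJd, hJc⟩ := exists_disjoint_dicut_covers src tgt r (τ / 6)
    (univ.filter fun a => 0 < f a) fun U hU _ => by
      have h1 := hmin U hU
      have h2 := card_outArcs_le_six_mul_card_pos src tgt f hf hb U hU.2.2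
      omega
  obtain ⟨J', hJP', hJd', hJc'⟩ := exists_disjoint_dicut_covers tgt src r (τ / 6)
    (univ.filter fun a => 0 < (-f) a) fun U hU _ => by
      have hU' := hU.reverse_compl
      have h1 := hmin Uᶜ hU'
      have h2 := card_outArcs_le_six_mul_card_pos src tgt (-f) (by rw [map_neg, hf, neg_zero])
        (fun a => by simpa using hb a) Uᶜ hU'.2.2
      rw [outArcs_reverse_compl] at h1 h2
      omega
  have hJJ' : ∀ i j, Disjoint (J i) (J' j) := by
    intro i j
    rw [Finset.disjoint_left]
    intro a h1 h2
    have h3 := (Finset.mem_filter.1 (hJP i h1)).2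
    have h4 := (Finset.mem_filter.1 (hJP' j h2)).2
    simp only [Pi.neg_apply] at h4
    omega
  refine ⟨fun i => J i ∪ J' i, fun i j hij => ?_, fun i U hU => ?_⟩
  · rw [Finset.disjoint_union_left, Finset.disjoint_union_right, Finset.disjoint_union_right]
    exact ⟨⟨hJd i j hij, hJJ' i j⟩, (hJJ' j i).symm, hJd' i j hij⟩
  · by_cases hr : r ∈ U
    · have := hJc' i Uᶜ hU.reverse_compl (by simpa using hr)
      rw [outArcs_reverse_compl] at this
      exact this.mono (inter_subset_inter_left subset_union_right)
    · exact (hJc i U hU hr).mono (inter_subset_inter_left subset_union_left)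
end
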